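/- arXiv:q-alg/9710035 — 5 statements merged into one kernel-verified Lean document; each statement's English description precedes it below -/
import Mathlib

section
/- For all a, b in gl, the two sums in the definition of C(a,b) have only finitely many nonzero terms, so C : gl × gl → ℂ is a well-defined bilinear map; moreover C is skew-symmetric, C(a,b) = −C(b,a), and satisfies the Lie-algebra 2-cocycle identity C([a,b],c) + C([b,c],a) + C([c,a],b) = 0 for all a, b, c in gl. -/
noncomputable section

/-!
The Lie algebra `gl` of `ℤ×ℤ` complex matrices with finitely many nonzero diagonals.
-/

/-- A `ℤ×ℤ` matrix (given as `a : ℤ → ℤ → ℂ`, `a i j` the `(i,j)` entry) belongs to `gl`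
iff it has only finitely many nonzero diagonals. -/
def IsGL (a : ℤ → ℤ → ℂ) : Prop := ∃ N : ℕ, ∀ i j : ℤ, (N : ℤ) < |i - j| → a i j = 0

/-- The matrix product on `gl`: each entry is a (finitely supported) sum. -/
def glMul (a b : ℤ → ℤ → ℂ) : ℤ → ℤ → ℂ := fun i j => ∑ᶠ k : ℤ, a i k * b k j

/-- The bracket `[a,b] = ab - ba` on `gl`. -/
def glBracket (a b : ℤ → ℤ → ℂ) : ℤ → ℤ → ℂ := fun i j => glMul a b i j - glMul b a i j

/-- The elementary matrix `E_{ij}`. -/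
def Emat (i j : ℤ) : ℤ → ℤ → ℂ := fun m n => if m = i ∧ n = j then 1 else 0

/-- The 2-cocycle `C(a,b) = Σ_{i≤0<j} a_{ij} b_{ji} - Σ_{j≤0<i} a_{ij} b_{ji}` on `gl`
(both sums are finitely supported for `a, b ∈ gl`). -/
def glCocycle (a b : ℤ → ℤ → ℂ) : ℂ :=
  (∑ᶠ p : ℤ × ℤ, if p.1 ≤ 0 ∧ 0 < p.2 then a p.1 p.2 * b p.2 p.1 else 0) -
  (∑ᶠ p : ℤ × ℤ, if p.2 ≤ 0 ∧ 0 < p.1 then a p.1 p.2 * b p.2 p.1 else 0)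

/-- `a` vanishes outside the `2 * N + 1` diagonals closest to the main one. -/
def IsBanded (N : ℕ) (a : ℤ → ℤ → ℂ) : Prop := ∀ i j : ℤ, (N : ℤ) < |i - j| → a i j = 0

theorem IsBanded.mono {N M : ℕ} {a : ℤ → ℤ → ℂ} (ha : IsBanded N a) (h : N ≤ M) :
    IsBanded M a := fun i j hij => ha i j (by omega)

/-- The indicator function of the nonpositive integers. -/
def nonposInd (i : ℤ) : ℂ := if i ≤ 0 then 1 else 0

theorem IsBanded.mem_Icc {N M : ℕ} (hM : N ≤ M) {b : ℤ → ℤ → ℂ} (hb : IsBanded N b) {i j : ℤ}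
    (hij : i ≤ 0 ∧ 0 < j ∨ j ≤ 0 ∧ 0 < i) (h : b j i ≠ 0) :
    i ∈ Finset.Icc (-M : ℤ) M ∧ j ∈ Finset.Icc (-M : ℤ) M := by
  have h1 : |j - i| ≤ N := not_lt.1 fun hlt => h (hb j i hlt)
  rw [abs_le] at h1
  simp only [Finset.mem_Icc]
  omega

theorem IsBanded.support_ite_subset {N M : ℕ} (hM : N ≤ M) {b : ℤ → ℤ → ℂ} (hb : IsBanded N b)
    (a : ℤ → ℤ → ℂ) (P : ℤ × ℤ → Prop) [DecidablePred P]
    (hP : ∀ p, P p → p.1 ≤ 0 ∧ 0 < p.2 ∨ p.2 ≤ 0 ∧ 0 < p.1) :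
    (Function.support fun p : ℤ × ℤ => if P p then a p.1 p.2 * b p.2 p.1 else 0) ⊆
      (Finset.Icc (-M : ℤ) M ×ˢ Finset.Icc (-M : ℤ) M : Finset (ℤ × ℤ)) := by
  intro p hp
  rw [Function.mem_support, ite_ne_right_iff] at hp
  exact Finset.mem_coe.2 (Finset.mem_product.2
    (hb.mem_Icc hM (hP p hp.1) (right_ne_zero_of_mul hp.2)))

theorem glCocycle_eq_sum {N M : ℕ} (hM : N ≤ M) (a : ℤ → ℤ → ℂ) {b : ℤ → ℤ → ℂ}
    (hb : IsBanded N b) :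
    glCocycle a b = ∑ i ∈ Finset.Icc (-M : ℤ) M, ∑ j ∈ Finset.Icc (-M : ℤ) M,
      (nonposInd i - nonposInd j) * (a i j * b j i) := by
  rw [glCocycle,
    finsum_eq_sum_of_support_subset _ (hb.support_ite_subset hM a _ fun _ h => Or.inl h),
    finsum_eq_sum_of_support_subset _ (hb.support_ite_subset hM a _ fun _ h => Or.inr h),
    ← Finset.sum_sub_distrib, Finset.sum_product]
  refine Finset.sum_congr rfl fun i _ => Finset.sum_congr rfl fun j _ => ?_
  by_cases hi : i ≤ 0 <;> by_cases hj : j ≤ 0 <;>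
    simp [nonposInd, hi, hj, not_lt.2, not_le.1]

theorem glCocycle_skew (a b : ℤ → ℤ → ℂ) : glCocycle a b = -glCocycle b a := by
  rw [glCocycle, glCocycle, neg_sub]
  congr 1
  all_goals
    exact (finsum_comp_equiv (Equiv.prodComm ℤ ℤ)).symm.trans
      (finsum_congr fun p => if_congr Iff.rfl (mul_comm _ _) rfl)

theorem glCocycle_add_left (a a' : ℤ → ℤ → ℂ) {b : ℤ → ℤ → ℂ} (hb : IsGL b) :
    glCocycle (fun i j => a i j + a' i j) b = glCocycle a b + glCocycle a' b := by
  obtain ⟨N, hN⟩ := hb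
  simp only [glCocycle_eq_sum le_rfl _ hN, ← Finset.sum_add_distrib, add_mul, mul_add]

theorem glCocycle_smul_left (s : ℂ) (a : ℤ → ℤ → ℂ) {b : ℤ → ℤ → ℂ} (hb : IsGL b) :
    glCocycle (fun i j => s * a i j) b = s * glCocycle a b := by
  obtain ⟨N, hN⟩ := hb
  simp only [glCocycle_eq_sum le_rfl _ hN, Finset.mul_sum]
  exact Finset.sum_congr rfl fun i _ => Finset.sum_congr rfl fun j _ => by ring

theorem glCocycle_glBracket_left (a b : ℤ → ℤ → ℂ) {c : ℤ → ℤ → ℂ} (hc : IsGL c) :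
    glCocycle (glBracket a b) c = glCocycle (glMul a b) c - glCocycle (glMul b a) c := by
  obtain ⟨N, hN⟩ := hc
  simp only [glCocycle_eq_sum le_rfl _ hN, ← Finset.sum_sub_distrib, glBracket, sub_mul, mul_sub]

theorem glMul_eq_sum {N : ℕ} {a : ℤ → ℤ → ℂ} (ha : IsBanded N a) (b : ℤ → ℤ → ℂ) {i : ℤ}
    (hi : i ∈ Finset.Icc (-N : ℤ) N) (k : ℤ) :
    glMul a b i k = ∑ j ∈ Finset.Icc (-(2 * N : ℕ) : ℤ) (2 * N : ℕ), a i j * b j k := by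
  refine finsum_eq_sum_of_support_subset _ fun j hj => ?_
  have h1 : |i - j| ≤ N := not_lt.1 fun hlt => left_ne_zero_of_mul hj (ha i j hlt)
  rw [abs_le] at h1
  simp only [Finset.coe_Icc, Set.mem_Icc, Finset.mem_Icc] at hi ⊢
  omega

theorem glCocycle_glMul_left {N : ℕ} {a c : ℤ → ℤ → ℂ} (ha : IsBanded N a) (b : ℤ → ℤ → ℂ)
    (hc : IsBanded N c) :
    glCocycle (glMul a b) c =
      ∑ i ∈ Finset.Icc (-(2 * N : ℕ) : ℤ) (2 * N : ℕ),
      ∑ k ∈ Finset.Icc (-(2 * N : ℕ) : ℤ) (2 * N : ℕ),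
      ∑ j ∈ Finset.Icc (-(2 * N : ℕ) : ℤ) (2 * N : ℕ),
        (nonposInd i - nonposInd k) * (a i j * b j k * c k i) := by
  rw [glCocycle_eq_sum (Nat.le_mul_of_pos_left N two_pos) _ hc]
  refine Finset.sum_congr rfl fun i _ => Finset.sum_congr rfl fun k _ => ?_
  rw [← Finset.mul_sum, ← Finset.sum_mul]
  by_cases hik : i ≤ 0 ∧ 0 < k ∨ k ≤ 0 ∧ 0 < i
  · by_cases hck : c k i = 0
    · simp [hck]
    · rw [glMul_eq_sum ha b (hc.mem_Icc le_rfl hik hck).1]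
  · have : nonposInd i = nonposInd k := by
      unfold nonposInd
      congr 1
      rw [eq_iff_iff]
      omega
    simp [this]

theorem glCocycle_glMul_cyclic {N : ℕ} {a b c : ℤ → ℤ → ℂ} (ha : IsBanded N a)
    (hb : IsBanded N b) (hc : IsBanded N c) :
    glCocycle (glMul a b) c + glCocycle (glMul b c) a + glCocycle (glMul c a) b = 0 := by
  rw [glCocycle_glMul_left ha b hc, glCocycle_glMul_left hb c ha, glCocycle_glMul_left hc a hb]
  generalize Finset.Icc (-(2 * N : ℕ) : ℤ) (2 * N : ℕ) = S
  have h2 : ∑ j ∈ S, ∑ i ∈ S, ∑ k ∈ S,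
        (nonposInd j - nonposInd i) * (b j k * c k i * a i j) =
      ∑ i ∈ S, ∑ k ∈ S, ∑ j ∈ S, (nonposInd j - nonposInd i) * (b j k * c k i * a i j) := by
    rw [Finset.sum_comm]
    exact Finset.sum_congr rfl fun i _ => Finset.sum_comm
  have h3 : ∑ k ∈ S, ∑ j ∈ S, ∑ i ∈ S,
        (nonposInd k - nonposInd j) * (c k i * a i j * b j k) =
      ∑ i ∈ S, ∑ k ∈ S, ∑ j ∈ S, (nonposInd k - nonposInd j) * (c k i * a i j * b j k) := by
    rw [Finset.sum_congr rfl fun k _ => Finset.sum_comm]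
    exact Finset.sum_comm
  rw [h2, h3]
  simp only [← Finset.sum_add_distrib]
  refine Finset.sum_eq_zero fun i _ => Finset.sum_eq_zero fun k _ =>
    Finset.sum_eq_zero fun j _ => ?_
  ring

/-- for `a, b ∈ gl` the two sums defining `C(a,b)` have finitely many nonzero
terms (so `C` is well defined); `C` is bilinear, skew-symmetric, and satisfies the
Lie algebra 2-cocycle identity. -/
theorem glCocycle_wellDefined_bilinear_skew_cocycle :
    (∀ a b : ℤ → ℤ → ℂ, IsGL a → IsGL b →
      {p : ℤ × ℤ | (if p.1 ≤ 0 ∧ 0 < p.2 then a p.1 p.2 * b p.2 p.1 else 0) ≠ 0}.Finite ∧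
      {p : ℤ × ℤ | (if p.2 ≤ 0 ∧ 0 < p.1 then a p.1 p.2 * b p.2 p.1 else 0) ≠ 0}.Finite) ∧
    (∀ a a' b : ℤ → ℤ → ℂ, IsGL a → IsGL a' → IsGL b →
      glCocycle (fun i j => a i j + a' i j) b = glCocycle a b + glCocycle a' b) ∧
    (∀ a b b' : ℤ → ℤ → ℂ, IsGL a → IsGL b → IsGL b' →
      glCocycle a (fun i j => b i j + b' i j) = glCocycle a b + glCocycle a b') ∧
    (∀ (s : ℂ) (a b : ℤ → ℤ → ℂ), IsGL a → IsGL b →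
      glCocycle (fun i j => s * a i j) b = s * glCocycle a b ∧
      glCocycle a (fun i j => s * b i j) = s * glCocycle a b) ∧
    (∀ a b : ℤ → ℤ → ℂ, IsGL a → IsGL b → glCocycle a b = - glCocycle b a) ∧
    (∀ a b c : ℤ → ℤ → ℂ, IsGL a → IsGL b → IsGL c →
      glCocycle (glBracket a b) c + glCocycle (glBracket b c) a
        + glCocycle (glBracket c a) b = 0) := by
  refine ⟨fun a b _ ⟨N, hN⟩ => ⟨?_, ?_⟩, fun a a' b _ _ hb => glCocycle_add_left a a' hb,
    fun a b b' ha _ _ => ?_, fun s a b ha hb => ⟨glCocycle_smul_left s a hb, ?_⟩,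
    fun a b _ _ => glCocycle_skew a b, fun a b c ha hb hc => ?_⟩
  · exact (Finset.finite_toSet _).subset
      (IsBanded.support_ite_subset le_rfl hN a _ fun _ h => Or.inl h)
  · exact (Finset.finite_toSet _).subset
      (IsBanded.support_ite_subset le_rfl hN a _ fun _ h => Or.inr h)
  · rw [glCocycle_skew, glCocycle_add_left b b' ha, glCocycle_skew a b, glCocycle_skew a b',
      neg_add]
  · rw [glCocycle_skew, glCocycle_smul_left s b ha, glCocycle_skew a b, mul_neg]
  · rw [glCocycle_glBracket_left a b hc, glCocycle_glBracket_left b c ha,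
      glCocycle_glBracket_left c a hb]
    obtain ⟨A, hA⟩ := ha
    obtain ⟨B, hB⟩ := hb
    obtain ⟨D, hD⟩ := hc
    have ha : IsBanded (A + B + D) a := IsBanded.mono hA (by omega)
    have hb : IsBanded (A + B + D) b := IsBanded.mono hB (by omega)
    have hc : IsBanded (A + B + D) c := IsBanded.mono hD (by omega)
    linear_combination glCocycle_glMul_cyclic ha hb hc - glCocycle_glMul_cyclic hb ha hc

end
end

section
/- (1) For every a ∈ gl and every x ∈ F, only finitely many terms of the sum Σ_{i,j∈ℤ} a_{ij} Ê_{ij} x are nonzero, so setting Ê(a)x := Σ_{i,j} a_{ij} Ê_{ij} x defines a linear map Ê : gl → End(F). (2) For all a, b ∈ gl one has [Ê(a), Ê(b)] = Ê(ab − ba) + l·C(a,b)·id_F; equivalently, the map a + λC ↦ Ê(a) + λ·l·id_F is a Lie algebra homomorphism from the one-dimensional central extension ĝl := gl ⊕ ℂC with bracket [a+λC, b+μC] = (ab−ba) + C(a,b)·C into End(F). In particular, [Ê_{ij}, Ê_{mn}] = δ_{jm} Ê_{in} − δ_{in} Ê_{mj} + l·δ_{jm} δ_{in} (χ(i≤0)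 − χ(j≤0))·id_F, where χ(i≤0) is 1 if i ≤ 0 and 0 otherwise. -/
/-!
Fermionic Fock space of `l` pairs of fermionic fields indexed by `½ + ℤ`.

The Fock space `FFock l` is the exterior algebra on the vector space `FV l` with basis
`v^{ε,p}_{-r}` for `ε ∈ {+,-}` (encoded as `Bool`, `true = +`), `1 ≤ p ≤ l`
(encoded as `Fin l`) and `r ∈ ½ + ℤ`, `r > 0` (encoded as `n : ℕ` with `r = n + ½`).

For `r > 0`, `ψ^{ε,p}_{-r}` is left exterior multiplication by the basis vector
`v^{ε,p}_{-r}`, and `ψ^{ε,p}_{r}` is the unique odd derivation (i.e. the left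
contraction) with `ψ^{ε,p}_{r}(v^{ε',q}_{-r'}) = δ_{ε',-ε} δ_{q,p} δ_{r',r}`.

A general mode `ψ^{ε,p}_{k - ½}` is encoded by `fermion ε p k` for `k : ℤ`.
-/

noncomputable section

/-- Basis index: `(ε, p, n)` corresponds to `v^{ε,p}_{-(n+½)}`. -/
abbrev FBas (l : ℕ) := Bool × Fin l × ℕ

abbrev FV (l : ℕ) := FBas l →₀ ℂ

/-- The fermionic Fock space: the exterior algebra `Λ(V)`. -/
abbrev FFock (l : ℕ) := ExteriorAlgebra ℂ (FV l)

/-- The vacuum vector `|0⟩ = 1`. -/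
def fvac (l : ℕ) : FFock l := 1

/-- Creation operator `ψ^{ε,p}_{-(n+½)}`: left exterior multiplication by `v^{ε,p}_{-(n+½)}`. -/
def psiCr (l : ℕ) (ε : Bool) (p : Fin l) (n : ℕ) : FFock l → FFock l :=
  fun x => ExteriorAlgebra.ι ℂ (Finsupp.single (ε, p, n) (1 : ℂ)) * x

/-- Annihilation operator `ψ^{ε,p}_{n+½}`: the odd derivation (left contraction) dual to
`v^{-ε,p}_{-(n+½)}`. -/
def psiAn (l : ℕ) (ε : Bool) (p : Fin l) (n : ℕ) : FFock l → FFock l :=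
  fun x => CliffordAlgebra.contractLeft (Q := (0 : QuadraticForm ℂ (FV l)))
    (Finsupp.lapply ((!ε, p, n) : FBas l)) x

/-- `fermion ε p k` is the mode `ψ^{ε,p}_{k-½}`, for `k : ℤ`. -/
def fermion (l : ℕ) (ε : Bool) (p : Fin l) (k : ℤ) : FFock l → FFock l :=
  if k ≤ 0 then psiCr l ε p (-k).toNat else psiAn l ε p (k - 1).toNat

/-- Normal ordered product `:ψ^{ε₁,p₁}_{k₁-½} ψ^{ε₂,p₂}_{k₂-½}:`, which is
`-ψ₂ ψ₁` if `k₁ - ½ > 0 > k₂ - ½` and `ψ₁ ψ₂` otherwise. -/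
def nPsi (l : ℕ) (ε₁ : Bool) (p₁ : Fin l) (k₁ : ℤ) (ε₂ : Bool) (p₂ : Fin l) (k₂ : ℤ) :
    FFock l → FFock l :=
  if 1 ≤ k₁ ∧ k₂ ≤ 0 then fun x => -(fermion l ε₂ p₂ k₂ (fermion l ε₁ p₁ k₁ x))
  else fun x => fermion l ε₁ p₁ k₁ (fermion l ε₂ p₂ k₂ x)

/-- `Ê_{ij} = Σ_{p=1}^{l} :ψ^{+,p}_{½-i} ψ^{-,p}_{j-½}:` (note `½ - i = (1-i) - ½`). -/
def Ehat (l : ℕ) (i j : ℤ) : FFock l → FFock l :=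
  fun x => ∑ p : Fin l, nPsi l true p (1 - i) false p j x

/-- `ê*^{pq} = Σ_{r ∈ ½+ℤ} :ψ^{+,p}_{-r} ψ^{-,q}_{r}:`, parametrizing `r = k - ½`, `k : ℤ`;
only finitely many summands act nonzero on a given vector, so the sum (`∑ᶠ`) is well defined. -/
def estar (l : ℕ) (p q : Fin l) : FFock l → FFock l :=
  fun x => ∑ᶠ k : ℤ, nPsi l true p (1 - k) false q k x

/-- `ê^{pq} = Σ_{r ∈ ½+ℤ} :ψ^{-,p}_{-r} ψ^{-,q}_{r}:`. -/
def ee (l : ℕ) (p q : Fin l) : FFock l → FFock l :=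
  fun x => ∑ᶠ k : ℤ, nPsi l false p (1 - k) false q k x

/-- `ê**^{pq} = Σ_{r ∈ ½+ℤ} :ψ^{+,p}_{-r} ψ^{+,q}_{r}:`. -/
def estarstar (l : ℕ) (p q : Fin l) : FFock l → FFock l :=
  fun x => ∑ᶠ k : ℤ, nPsi l true p (1 - k) true q k x

/-- The action `Ê(a) x := Σ_{i,j ∈ ℤ} a_{ij} Ê_{ij} x` of `gl` on the Fock space
(the sum is finitely supported for each `x`, by part (1) of the theorem below). -/
def EhatGL (l : ℕ) (a : ℤ → ℤ → ℂ) : FFock l → FFock l :=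
  fun x => ∑ᶠ p : ℤ × ℤ, a p.1 p.2 • Ehat l p.1 p.2 x

/-- The mode `fermion l ε p k` as a linear endomorphism of the Fock space. -/
def fermionEnd (l : ℕ) (ε : Bool) (p : Fin l) (k : ℤ) : Module.End ℂ (FFock l) :=
  if k ≤ 0 then
    LinearMap.mulLeft ℂ (ExteriorAlgebra.ι ℂ (Finsupp.single (ε, p, (-k).toNat) (1 : ℂ)))
  else CliffordAlgebra.contractLeft (Q := (0 : QuadraticForm ℂ (FV l)))
    (Finsupp.lapply ((!ε, p, (k - 1).toNat) : FBas l))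

theorem fermion_eq_fermionEnd (l : ℕ) (ε : Bool) (p : Fin l) (k : ℤ) (x : FFock l) :
    fermion l ε p k x = fermionEnd l ε p k x := by
  unfold fermion fermionEnd
  split_ifs <;> rfl

theorem contractLeft_ι_mul_add {l : ℕ} (d : Module.Dual ℂ (FV l)) (v : FV l) (x : FFock l) :
    CliffordAlgebra.contractLeft (Q := (0 : QuadraticForm ℂ (FV l))) d (ExteriorAlgebra.ι ℂ v * x)
      + ExteriorAlgebra.ι ℂ v * CliffordAlgebra.contractLeft
          (Q := (0 : QuadraticForm ℂ (FV l))) d x = d v • x := by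
  have h := CliffordAlgebra.contractLeft_ι_mul (Q := (0 : QuadraticForm ℂ (FV l))) d v x
  exact eq_sub_iff_add_eq.mp h

/-- The canonical anticommutation relations of the modes. -/
theorem fermionEnd_anticomm (l : ℕ) (ε ε' : Bool) (p q : Fin l) (k k' : ℤ) :
    fermionEnd l ε p k * fermionEnd l ε' q k' + fermionEnd l ε' q k' * fermionEnd l ε p k
      = if ε' = !ε ∧ q = p ∧ k + k' = 1 then 1 else 0 := by
  refine LinearMap.ext fun x => ?_
  unfold fermionEnd
  by_cases hk : k ≤ 0 <;> by_cases hk' : k' ≤ 0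
  · have h0 : ¬ (ε' = !ε ∧ q = p ∧ k + k' = 1) := by rintro ⟨-, -, h⟩; omega
    simp only [hk, hk', h0, if_true, if_false, LinearMap.add_apply, Module.End.mul_apply,
      LinearMap.mulLeft_apply, ← mul_assoc, ← add_mul, ExteriorAlgebra.ι_add_mul_swap, zero_mul,
      LinearMap.zero_apply]
  · simp only [hk, hk', if_true, if_false, LinearMap.add_apply, Module.End.mul_apply,
      LinearMap.mulLeft_apply]
    rw [add_comm, contractLeft_ι_mul_add]
    have h : (((ε, p, (-k).toNat) : FBas l) = (!ε', q, (k' - 1).toNat)) ↔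
        (ε' = !ε ∧ q = p ∧ k + k' = 1) := by
      simp only [Prod.mk.injEq]
      refine and_congr ?_ (and_congr eq_comm (by omega))
      cases ε <;> cases ε' <;> simp
    simp only [Finsupp.lapply_apply, Finsupp.single_apply, h]
    split_ifs <;> simp
  · simp only [hk, hk', if_true, if_false, LinearMap.add_apply, Module.End.mul_apply,
      LinearMap.mulLeft_apply]
    rw [contractLeft_ι_mul_add]
    have h : (((ε', q, (-k').toNat) : FBas l) = (!ε, p, (k - 1).toNat)) ↔
        (ε' = !ε ∧ q = p ∧ k + k' = 1) := by
      simp only [Prod.mk.injEq]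
      exact and_congr Iff.rfl (and_congr Iff.rfl (by omega))
    simp only [Finsupp.lapply_apply, Finsupp.single_apply, h]
    split_ifs <;> simp
  · have h0 : ¬ (ε' = !ε ∧ q = p ∧ k + k' = 1) := by rintro ⟨-, -, h⟩; omega
    simp only [hk, hk', h0, if_false, LinearMap.add_apply, Module.End.mul_apply,
      LinearMap.zero_apply]
    rw [CliffordAlgebra.contractLeft_comm, neg_add_cancel]

/-- Every vector is annihilated by all but finitely many annihilation modes. -/
theorem exists_fermionEnd_eq_zero (l : ℕ) (x : FFock l) :
    ∃ M : ℕ, ∀ (ε : Bool) (p : Fin l) (k : ℤ), (M : ℤ) < k → fermionEnd l ε p k x = 0 := by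
  induction x using CliffordAlgebra.left_induction with
  | algebraMap r =>
    refine ⟨0, fun ε p k hk => ?_⟩
    rw [fermionEnd, if_neg (by omega)]
    exact CliffordAlgebra.contractLeft_algebraMap _ _ _
  | add x y hx hy =>
    obtain ⟨M, hM⟩ := hx
    obtain ⟨N, hN⟩ := hy
    refine ⟨max M N, fun ε p k hk => ?_⟩
    rw [map_add, hM _ _ _ (by omega), hN _ _ _ (by omega), add_zero]
  | ι_mul x v hx =>
    obtain ⟨M, hM⟩ := hx
    refine ⟨max M (v.support.sup (fun b => b.2.2) + 1), fun ε p k hk => ?_⟩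
    have hx0 := hM ε p k (by omega)
    have hv : v (!ε, p, (k - 1).toNat) = 0 := by
      by_contra hne
      have := Finset.le_sup (f := fun b : FBas l => b.2.2) (Finsupp.mem_support_iff.mpr hne)
      simp only at this
      omega
    rw [fermionEnd, if_neg (by omega)] at hx0 ⊢
    rw [CliffordAlgebra.contractLeft_ι_mul, hx0, Finsupp.lapply_apply, hv, zero_smul, mul_zero,
      sub_zero]

/-- The operator `Ê_{ij}` before normal ordering. -/
def bilinEnd (l : ℕ) (i j : ℤ) : Module.End ℂ (FFock l) :=
  ∑ p : Fin l, fermionEnd l true p (1 - i) * fermionEnd l false p j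

/-- `Ê_{ij}` as a linear endomorphism of the Fock space. -/
def EhatEnd (l : ℕ) (i j : ℤ) : Module.End ℂ (FFock l) :=
  bilinEnd l i j - (if i = j ∧ i ≤ 0 then (l : ℂ) else 0) • 1

theorem nPsi_eq (l : ℕ) (p : Fin l) (i j : ℤ) (x : FFock l) :
    nPsi l true p (1 - i) false p j x
      = fermionEnd l true p (1 - i) (fermionEnd l false p j x)
        - if i = j ∧ i ≤ 0 then x else 0 := by
  have h := LinearMap.congr_fun (fermionEnd_anticomm l true false p p (1 - i) j) x
  simp only [LinearMap.add_apply, Module.End.mul_apply, Bool.not_true, true_and] at h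
  unfold nPsi
  simp only [fermion_eq_fermionEnd]
  by_cases hij : 1 ≤ 1 - i ∧ j ≤ 0
  · rw [if_pos hij]
    rw [← eq_sub_iff_add_eq'] at h
    rw [h]
    have : 1 - i + j = 1 ↔ i = j ∧ i ≤ 0 := by omega
    simp only [this]
    split_ifs <;> simp
  · rw [if_neg hij, if_neg (by omega), sub_zero]

theorem Ehat_eq_EhatEnd (l : ℕ) (i j : ℤ) (x : FFock l) : Ehat l i j x = EhatEnd l i j x := by
  simp only [Ehat, nPsi_eq, EhatEnd, bilinEnd, Finset.sum_sub_distrib, LinearMap.sub_apply,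
    LinearMap.sum_apply, Module.End.mul_apply]
  split_ifs <;> simp [Nat.cast_smul_eq_nsmul]

theorem mul_mul_commutator {R : Type*} [Ring R] (A B C D : R) :
    A * B * (C * D) - C * D * (A * B)
      = A * (B * C + C * B) * D - A * C * (B * D + D * B) + (A * C + C * A) * (D * B)
        - C * (A * D + D * A) * B := by
  noncomm_ring

theorem bilinEnd_commutator (l : ℕ) (i j m n : ℤ) :
    bilinEnd l i j * bilinEnd l m n - bilinEnd l m n * bilinEnd l i j
      = (if j = m then bilinEnd l i n else 0) - (if i = n then bilinEnd l m j else 0) := by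
  have key : ∀ p q : Fin l,
      fermionEnd l true p (1 - i) * fermionEnd l false p j *
          (fermionEnd l true q (1 - m) * fermionEnd l false q n)
        - fermionEnd l true q (1 - m) * fermionEnd l false q n *
          (fermionEnd l true p (1 - i) * fermionEnd l false p j)
      = (if q = p then
          (if j = m then fermionEnd l true p (1 - i) * fermionEnd l false p n else 0)
          - (if i = n then fermionEnd l true p (1 - m) * fermionEnd l false p j else 0)
        else 0) := by
    intro p q
    rw [mul_mul_commutator]
    simp only [fermionEnd_anticomm]
    have h1 : j + (1 - m) = 1 ↔ j = m := by omega
    have h2 : 1 - i + n = 1 ↔ i = n := by omega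
    simp only [h1, h2, Bool.not_true, Bool.not_false, Bool.true_eq_false, Bool.false_eq_true,
      true_and, false_and, if_false]
    by_cases hpq : q = p
    · subst hpq
      simp only [eq_self, true_and, if_true]
      split_ifs <;> simp
    · simp [hpq]
  simp only [bilinEnd]
  rw [Finset.sum_mul_sum, Finset.sum_mul_sum, Finset.sum_comm, ← Finset.sum_sub_distrib]
  simp only [← Finset.sum_sub_distrib]
  rw [Finset.sum_comm]
  simp only [key, Finset.sum_ite_eq', Finset.mem_univ, if_true]
  rw [Finset.sum_sub_distrib]
  congr 1 <;> split_ifs <;> simp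

theorem EhatEnd_commutator (l : ℕ) (i j m n : ℤ) :
    EhatEnd l i j * EhatEnd l m n - EhatEnd l m n * EhatEnd l i j
      = (if j = m then EhatEnd l i n else 0) - (if i = n then EhatEnd l m j else 0)
        + ((l : ℂ) * (if j = m then 1 else 0) * (if i = n then 1 else 0)
            * ((if i ≤ 0 then (1 : ℂ) else 0) - (if j ≤ 0 then (1 : ℂ) else 0))) •
          (1 : Module.End ℂ (FFock l)) := by
  have hcomm : EhatEnd l i j * EhatEnd l m n - EhatEnd l m n * EhatEnd l i j
      = bilinEnd l i j * bilinEnd l m n - bilinEnd l m n * bilinEnd l i j := by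
    unfold EhatEnd
    simp only [sub_mul, mul_sub, smul_mul_assoc, mul_smul_comm, one_mul, mul_one]
    module
  rw [hcomm, bilinEnd_commutator]
  unfold EhatEnd
  by_cases hjm : j = m <;> by_cases hin : i = n
  · subst hjm hin
    by_cases hi : i ≤ 0 <;> by_cases hj : j ≤ 0 <;> simp [hi, hj] <;> module
  · simp [hjm, hin]
  · simp [hjm, hin, Ne.symm hjm]
  · simp [hjm, hin]

theorem exists_bound_EhatEnd (l : ℕ) (x : FFock l) :
    ∃ M : ℕ, ∀ i j : ℤ, EhatEnd l i j x ≠ 0 → -(M : ℤ) ≤ i ∧ j ≤ M := by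
  obtain ⟨M, hM⟩ := exists_fermionEnd_eq_zero l x
  refine ⟨M, fun i j h => ?_⟩
  contrapose! h
  rw [← Ehat_eq_EhatEnd, Ehat]
  refine Finset.sum_eq_zero fun p _ => ?_
  by_cases hj : (M : ℤ) < j
  · rw [nPsi_eq, hM _ _ _ hj, map_zero, if_neg (by omega), sub_zero]
  · have hi : (M : ℤ) < 1 - i := by omega
    have hc := LinearMap.congr_fun (fermionEnd_anticomm l true false p p (1 - i) j) x
    simp only [LinearMap.add_apply, Module.End.mul_apply, Bool.not_true, true_and,
      hM _ _ _ hi, map_zero, add_zero] at hc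
    have : 1 - i + j = 1 ↔ i = j ∧ i ≤ 0 := by omega
    rw [nPsi_eq, hc]
    simp only [this]
    split_ifs <;> simp

theorem IsGL.exists_bound {a : ℤ → ℤ → ℂ} (ha : IsGL a) :
    ∃ N : ℕ, ∀ i j : ℤ, a i j ≠ 0 → i - j ≤ N ∧ j - i ≤ N := by
  obtain ⟨N, hN⟩ := ha
  refine ⟨N, fun i j h => ?_⟩
  have : ¬ (N : ℤ) < |i - j| := fun hlt => h (hN i j hlt)
  rw [not_lt, abs_le] at this
  omega

theorem IsGL.hasFiniteSupport_smul {a : ℤ → ℤ → ℂ} (ha : IsGL a) (l : ℕ) (x : FFock l) :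
    Function.HasFiniteSupport fun p : ℤ × ℤ => a p.1 p.2 • EhatEnd l p.1 p.2 x := by
  obtain ⟨N, hN⟩ := ha.exists_bound
  obtain ⟨M, hM⟩ := exists_bound_EhatEnd l x
  refine (Set.finite_Icc ((-(M + N : ℤ), -(M + N : ℤ)) : ℤ × ℤ) (M + N, M + N)).subset ?_
  rintro ⟨i, j⟩ h
  obtain ⟨h1, h2⟩ := smul_ne_zero_iff.mp h
  have := hN _ _ h1
  have := hM _ _ h2
  simp only [Set.mem_Icc, Prod.mk_le_mk] at *
  omega

theorem IsGL.glMul {a b : ℤ → ℤ → ℂ} (ha : IsGL a) (hb : IsGL b) : IsGL (glMul a b) := by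
  obtain ⟨N, hN⟩ := ha.exists_bound
  obtain ⟨N', hN'⟩ := hb.exists_bound
  refine ⟨N + N', fun i j hij => ?_⟩
  refine (finsum_congr fun k => ?_).trans finsum_zero
  by_contra h
  have := hN _ _ (left_ne_zero_of_mul h)
  have := hN' _ _ (right_ne_zero_of_mul h)
  have : |i - j| ≤ ((N + N' : ℕ) : ℤ) := by rw [abs_le]; omega
  omega

theorem EhatGL_eq (l : ℕ) (a : ℤ → ℤ → ℂ) (x : FFock l) :
    EhatGL l a x = ∑ᶠ p : ℤ × ℤ, a p.1 p.2 • EhatEnd l p.1 p.2 x := by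
  simp only [EhatGL, Ehat_eq_EhatEnd]

theorem hasFiniteSupport_smul_mul {a b : ℤ → ℤ → ℂ} (ha : IsGL a) (hb : IsGL b) (l : ℕ)
    (x : FFock l) :
    Function.HasFiniteSupport fun r : (ℤ × ℤ) × (ℤ × ℤ) =>
      (a r.1.1 r.1.2 * b r.2.1 r.2.2) •
        EhatEnd l r.1.1 r.1.2 (EhatEnd l r.2.1 r.2.2 x) := by
  refine ((hb.hasFiniteSupport_smul l x).biUnion fun q _ =>
    (ha.hasFiniteSupport_smul l (EhatEnd l q.1 q.2 x)).image fun p => (p, q)).subset ?_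
  rintro ⟨p, q⟩ h
  obtain ⟨hab, hE⟩ := smul_ne_zero_iff.mp h
  have hE' : EhatEnd l q.1 q.2 x ≠ 0 := by
    intro h0
    exact hE (by rw [h0, map_zero])
  simp only [Set.mem_iUnion, Set.mem_image]
  exact ⟨q, smul_ne_zero (right_ne_zero_of_mul hab) hE', p,
    smul_ne_zero (left_ne_zero_of_mul hab) hE, rfl⟩

theorem EhatGL_EhatGL {a b : ℤ → ℤ → ℂ} (ha : IsGL a) (hb : IsGL b) (l : ℕ) (x : FFock l) :
    EhatGL l a (EhatGL l b x) = ∑ᶠ r : (ℤ × ℤ) × (ℤ × ℤ),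
      (a r.1.1 r.1.2 * b r.2.1 r.2.2) • EhatEnd l r.1.1 r.1.2 (EhatEnd l r.2.1 r.2.2 x) := by
  rw [finsum_curry _ (hasFiniteSupport_smul_mul ha hb l x), EhatGL_eq, EhatGL_eq]
  refine finsum_congr fun p => ?_
  rw [map_finsum _ (hb.hasFiniteSupport_smul l x), smul_finsum]
  refine finsum_congr fun q => ?_
  rw [map_smul, smul_smul]

theorem hasFiniteSupport_glMul {a b : ℤ → ℤ → ℂ} (ha : IsGL a) (hb : IsGL b) (l : ℕ)
    (x : FFock l) :
    Function.HasFiniteSupport fun r : (ℤ × ℤ) × (ℤ × ℤ) =>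
      (a r.1.1 r.1.2 * b r.2.1 r.2.2) • if r.1.2 = r.2.1 then EhatEnd l r.1.1 r.2.2 x else 0 := by
  obtain ⟨N, hN⟩ := ha.exists_bound
  obtain ⟨N', hN'⟩ := hb.exists_bound
  obtain ⟨M, hM⟩ := exists_bound_EhatEnd l x
  set K : ℤ := M + N + N'
  refine (Set.finite_Icc (((-K, -K), (-K, -K)) : (ℤ × ℤ) × (ℤ × ℤ)) ((K, K), (K, K))).subset ?_
  rintro ⟨⟨i, j⟩, ⟨m, n⟩⟩ h
  obtain ⟨hab, hE⟩ := smul_ne_zero_iff.mp h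
  obtain ⟨hjm, hE⟩ := ite_ne_right_iff.mp hE
  have := hN _ _ (left_ne_zero_of_mul hab)
  have := hN' _ _ (right_ne_zero_of_mul hab)
  have := hM _ _ hE
  simp only [Set.mem_Icc, Prod.mk_le_mk] at *
  omega

theorem finsum_glMul {a b : ℤ → ℤ → ℂ} (ha : IsGL a) (hb : IsGL b) (l : ℕ) (x : FFock l) :
    (∑ᶠ r : (ℤ × ℤ) × (ℤ × ℤ),
      (a r.1.1 r.1.2 * b r.2.1 r.2.2) • if r.1.2 = r.2.1 then EhatEnd l r.1.1 r.2.2 x else 0)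
      = ∑ᶠ p : ℤ × ℤ, glMul a b p.1 p.2 • EhatEnd l p.1 p.2 x := by
  let e : (ℤ × ℤ) × (ℤ × ℤ) ≃ (ℤ × ℤ) × (ℤ × ℤ) :=
    ⟨fun t => ((t.1.1, t.2.1), (t.2.2, t.1.2)), fun r => ((r.1.1, r.2.2), (r.1.2, r.2.1)),
      fun _ => rfl, fun _ => rfl⟩
  have hf := (hasFiniteSupport_glMul ha hb l x).preimage (f := e) e.injective.injOn
  rw [← finsum_comp_equiv e, finsum_curry _ hf]
  refine finsum_congr fun p => ?_
  have hp : Function.HasFiniteSupport fun t : ℤ × ℤ =>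
      (a p.1 t.1 * b t.2 p.2) • if t.1 = t.2 then EhatEnd l p.1 p.2 x else 0 :=
    hf.preimage (f := fun t => (p, t)) (Prod.mk_right_injective p).injOn
  rw [glMul, finsum_smul]
  refine (finsum_curry _ hp).trans (finsum_congr fun k => ?_)
  rw [finsum_eq_single _ k fun m hm => by simp [Ne.symm hm]]
  simp

theorem IsGL.hasFiniteSupport_cocycle {a : ℤ → ℤ → ℂ} (ha : IsGL a) (b : ℤ → ℤ → ℂ) :
    (Function.HasFiniteSupport fun p : ℤ × ℤ =>
      if p.1 ≤ 0 ∧ 0 < p.2 then a p.1 p.2 * b p.2 p.1 else 0) ∧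
    (Function.HasFiniteSupport fun p : ℤ × ℤ =>
      if p.2 ≤ 0 ∧ 0 < p.1 then a p.1 p.2 * b p.2 p.1 else 0) := by
  obtain ⟨N, hN⟩ := ha.exists_bound
  constructor <;>
  · refine (Set.finite_Icc ((-N, -N) : ℤ × ℤ) (N, N)).subset ?_
    rintro ⟨i, j⟩ h
    obtain ⟨hij, h⟩ := ite_ne_right_iff.mp h
    have := hN _ _ (left_ne_zero_of_mul h)
    simp only [Set.mem_Icc, Prod.mk_le_mk] at *
    omega

theorem IsGL.glCocycle_eq {a : ℤ → ℤ → ℂ} (ha : IsGL a) (b : ℤ → ℤ → ℂ) :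
    glCocycle a b = ∑ᶠ p : ℤ × ℤ, a p.1 p.2 * b p.2 p.1 *
      ((if p.1 ≤ 0 then (1 : ℂ) else 0) - (if p.2 ≤ 0 then (1 : ℂ) else 0)) := by
  obtain ⟨h1, h2⟩ := ha.hasFiniteSupport_cocycle b
  rw [glCocycle, ← finsum_sub_distrib h1 h2]
  refine finsum_congr fun p => ?_
  by_cases hi : p.1 ≤ 0 <;> by_cases hj : p.2 ≤ 0 <;> simp [hi, hj, not_lt.mpr, not_le.mp]

theorem IsGL.hasFiniteSupport_central {a : ℤ → ℤ → ℂ} (ha : IsGL a) (b : ℤ → ℤ → ℂ) (c : ℂ) :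
    Function.HasFiniteSupport fun r : (ℤ × ℤ) × (ℤ × ℤ) =>
      a r.1.1 r.1.2 * b r.2.1 r.2.2 *
        (c * (if r.1.2 = r.2.1 then 1 else 0) * (if r.1.1 = r.2.2 then 1 else 0)
          * ((if r.1.1 ≤ 0 then (1 : ℂ) else 0) - (if r.1.2 ≤ 0 then (1 : ℂ) else 0))) := by
  obtain ⟨N, hN⟩ := ha.exists_bound
  refine (Set.finite_Icc (((-N, -N), (-N, -N)) : (ℤ × ℤ) × (ℤ × ℤ)) ((N, N), (N, N))).subset ?_
  rintro ⟨⟨i, j⟩, ⟨m, n⟩⟩ h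
  obtain ⟨hab, h⟩ := mul_ne_zero_iff.mp h
  obtain ⟨h, hχ⟩ := mul_ne_zero_iff.mp h
  obtain ⟨h, hin⟩ := mul_ne_zero_iff.mp h
  have hjm := (ite_ne_right_iff.mp (right_ne_zero_of_mul h)).1
  have hin := (ite_ne_right_iff.mp hin).1
  have hb := hN _ _ (left_ne_zero_of_mul hab)
  have hij : ¬ (i ≤ 0 ↔ j ≤ 0) := fun h => hχ (by simp [h])
  simp only [Set.mem_Icc, Prod.mk_le_mk] at *
  omega

theorem IsGL.finsum_central {a : ℤ → ℤ → ℂ} (ha : IsGL a) (b : ℤ → ℤ → ℂ) (c : ℂ) :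
    (∑ᶠ r : (ℤ × ℤ) × (ℤ × ℤ), a r.1.1 r.1.2 * b r.2.1 r.2.2 *
        (c * (if r.1.2 = r.2.1 then 1 else 0) * (if r.1.1 = r.2.2 then 1 else 0)
          * ((if r.1.1 ≤ 0 then (1 : ℂ) else 0) - (if r.1.2 ≤ 0 then (1 : ℂ) else 0))))
      = c * glCocycle a b := by
  rw [finsum_curry _ (ha.hasFiniteSupport_central b c), ha.glCocycle_eq, ← smul_eq_mul,
    smul_finsum]
  refine finsum_congr fun p => ?_
  rw [finsum_eq_single _ p.swap]
  · simp only [Prod.fst_swap, Prod.snd_swap, if_true, smul_eq_mul]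
    ring
  · rintro ⟨m, n⟩ hq
    by_cases h1 : p.2 = m
    · have h2 : p.1 ≠ n := fun h2 => hq (by simp [Prod.swap, h1, h2])
      simp [h2]
    · simp [h1]

theorem EhatGL_commutator {a b : ℤ → ℤ → ℂ} (ha : IsGL a) (hb : IsGL b) (l : ℕ) (x : FFock l) :
    EhatGL l a (EhatGL l b x) - EhatGL l b (EhatGL l a x)
      = EhatGL l (glBracket a b) x + ((l : ℂ) * glCocycle a b) • x := by
  let e : (ℤ × ℤ) × (ℤ × ℤ) ≃ (ℤ × ℤ) × (ℤ × ℤ) := Equiv.prodComm _ _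
  have hba := (hasFiniteSupport_smul_mul hb ha l x).preimage (f := e) e.injective.injOn
  have hgl := (hasFiniteSupport_glMul hb ha l x).preimage (f := e) e.injective.injOn
  have hc : Function.HasFiniteSupport fun r : (ℤ × ℤ) × (ℤ × ℤ) =>
      (a r.1.1 r.1.2 * b r.2.1 r.2.2 *
        ((l : ℂ) * (if r.1.2 = r.2.1 then 1 else 0) * (if r.1.1 = r.2.2 then 1 else 0)
          * ((if r.1.1 ≤ 0 then (1 : ℂ) else 0) - (if r.1.2 ≤ 0 then (1 : ℂ) else 0)))) • x :=
    (ha.hasFiniteSupport_central b l).subset fun _ h => left_ne_zero_of_smul h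
  have hbr : EhatGL l (glBracket a b) x
      = (∑ᶠ p : ℤ × ℤ, glMul a b p.1 p.2 • EhatEnd l p.1 p.2 x)
        - ∑ᶠ p : ℤ × ℤ, glMul b a p.1 p.2 • EhatEnd l p.1 p.2 x := by
    rw [EhatGL_eq, ← finsum_sub_distrib]
    · simp only [glBracket, sub_smul]
    · exact (ha.glMul hb).hasFiniteSupport_smul l x
    · exact (hb.glMul ha).hasFiniteSupport_smul l x
  rw [hbr, ← finsum_glMul ha hb, ← finsum_glMul hb ha, ← ha.finsum_central b l, finsum_smul,
    EhatGL_EhatGL ha hb, EhatGL_EhatGL hb ha,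
    ← finsum_comp_equiv e (f := fun r : (ℤ × ℤ) × (ℤ × ℤ) =>
      (b r.1.1 r.1.2 * a r.2.1 r.2.2) •
        EhatEnd l r.1.1 r.1.2 (EhatEnd l r.2.1 r.2.2 x)),
    ← finsum_sub_distrib (hasFiniteSupport_smul_mul ha hb l x) hba]
  rw [← finsum_comp_equiv e (f := fun r : (ℤ × ℤ) × (ℤ × ℤ) =>
      (b r.1.1 r.1.2 * a r.2.1 r.2.2) • if r.1.2 = r.2.1 then EhatEnd l r.1.1 r.2.2 x else 0),
    ← finsum_sub_distrib (hasFiniteSupport_glMul ha hb l x) hgl]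
  refine (finsum_congr fun r => ?_).trans
    (finsum_add_distrib ((hasFiniteSupport_glMul ha hb l x).sub hgl) hc)
  obtain ⟨⟨i, j⟩, ⟨m, n⟩⟩ := r
  have h := LinearMap.congr_fun (EhatEnd_commutator l i j m n) x
  simp only [e, Equiv.prodComm_apply, Prod.swap_prod_mk]
  rw [mul_comm (b m n), ← smul_sub, ← smul_sub, mul_smul _ _ x, ← smul_add]
  congr 1
  simp only [LinearMap.sub_apply, LinearMap.add_apply, LinearMap.smul_apply, Module.End.mul_apply,
    Module.End.one_apply] at h
  rw [h]
  simp only [@eq_comm ℤ n i]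
  split_ifs <;> rfl

/-- (1) for `a ∈ gl` and `x ∈ F`, only finitely many terms of
`Σ_{i,j} a_{ij} Ê_{ij} x` are nonzero, so `Ê : gl → End(F)` is well defined;
(2) `[Ê(a), Ê(b)] = Ê(ab - ba) + l·C(a,b)·id`, i.e. `a + λC ↦ Ê(a) + λ·l·id` is a
representation of the central extension `ĝl = gl ⊕ ℂC` on `F`; in particular
`[Ê_{ij}, Ê_{mn}] = δ_{jm} Ê_{in} - δ_{in} Ê_{mj} + l·δ_{jm}δ_{in}(χ(i≤0) - χ(j≤0))·id`. -/
theorem EhatGL_wellDefined_and_representation (l : ℕ) (hl : 1 ≤ l) :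
    (∀ (a : ℤ → ℤ → ℂ), IsGL a → ∀ x : FFock l,
      {p : ℤ × ℤ | a p.1 p.2 • Ehat l p.1 p.2 x ≠ 0}.Finite) ∧
    (∀ (a b : ℤ → ℤ → ℂ), IsGL a → IsGL b → ∀ x : FFock l,
      EhatGL l a (EhatGL l b x) - EhatGL l b (EhatGL l a x)
        = EhatGL l (glBracket a b) x + ((l : ℂ) * glCocycle a b) • x) ∧
    (∀ (i j m n : ℤ) (x : FFock l),
      Ehat l i j (Ehat l m n x) - Ehat l m n (Ehat l i j x)
        = (if j = m then Ehat l i n x else 0) - (if i = n then Ehat l m j x else 0)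
          + (((l : ℂ) * (if j = m then 1 else 0) * (if i = n then 1 else 0)
              * ((if i ≤ 0 then (1 : ℂ) else 0) - (if j ≤ 0 then (1 : ℂ) else 0))) • x)) := by
  refine ⟨fun a ha x => ?_, fun a b ha hb x => EhatGL_commutator ha hb l x, fun i j m n x => ?_⟩
  · simp only [Ehat_eq_EhatEnd]
    exact ha.hasFiniteSupport_smul l x
  · have h := LinearMap.congr_fun (EhatEnd_commutator l i j m n) x
    simp only [LinearMap.sub_apply, LinearMap.add_apply, LinearMap.smul_apply,
      Module.End.mul_apply, Module.End.one_apply] at h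
    simp only [Ehat_eq_EhatEnd, h]
    congr 2 <;> split_ifs <;> rfl

end
end

section
/- For all i, j ∈ ℤ and all 1 ≤ p, q ≤ l with p ≠ q, the operator D̂_{ij} := Ê_{ij} − Ê_{1−j,1−i} commutes with ê^{pq} and with ê**^{pq}: [D̂_{ij}, ê^{pq}] = 0 and [D̂_{ij}, ê**^{pq}] = 0. -/
/-!
Fermionic Fock space of `l` pairs of fermionic fields indexed by `½ + ℤ`.

The Fock space `FFock l` is the exterior algebra on the vector space `FV l` with basis
`v^{ε,p}_{-r}` for `ε ∈ {+,-}` (encoded as `Bool`, `true = +`), `1 ≤ p ≤ l`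
(encoded as `Fin l`) and `r ∈ ½ + ℤ`, `r > 0` (encoded as `n : ℕ` with `r = n + ½`).

For `r > 0`, `ψ^{ε,p}_{-r}` is left exterior multiplication by the basis vector
`v^{ε,p}_{-r}`, and `ψ^{ε,p}_{r}` is the unique odd derivation (i.e. the left
contraction) with `ψ^{ε,p}_{r}(v^{ε',q}_{-r'}) = δ_{ε',-ε} δ_{q,p} δ_{r',r}`.

A general mode `ψ^{ε,p}_{k - ½}` is encoded by `fermion ε p k` for `k : ℤ`.
-/

noncomputable section

/-- `D̂_{ij} := Ê_{ij} - Ê_{1-j,1-i}`. -/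
def Dhat (l : ℕ) (i j : ℤ) : FFock l → FFock l :=
  fun x => Ehat l i j x - Ehat l (1 - j) (1 - i) x

/-- The mode `ψ^{ε,p}_{k-½}` as a linear endomorphism of the Fock space. -/
def fermionHom (l : ℕ) (ε : Bool) (p : Fin l) (k : ℤ) : FFock l →ₗ[ℂ] FFock l :=
  if k ≤ 0 then
    LinearMap.mulLeft ℂ (ExteriorAlgebra.ι ℂ (Finsupp.single (ε, p, (-k).toNat) (1 : ℂ)))
  else CliffordAlgebra.contractLeft (Q := (0 : QuadraticForm ℂ (FV l)))
    (Finsupp.lapply ((!ε, p, (k - 1).toNat) : FBas l))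

lemma fermion_eq_fermionHom (l : ℕ) (ε : Bool) (p : Fin l) (k : ℤ) :
    fermion l ε p k = fermionHom l ε p k := by
  unfold fermion fermionHom
  split_ifs <;> rfl

lemma psiCr_psiCr_add (l : ℕ) (ε₁ ε₂ : Bool) (p₁ p₂ : Fin l) (m n : ℕ) (x : FFock l) :
    psiCr l ε₁ p₁ m (psiCr l ε₂ p₂ n x) + psiCr l ε₂ p₂ n (psiCr l ε₁ p₁ m x) = 0 := by
  simp only [psiCr, ← mul_assoc, ← add_mul]
  rw [ExteriorAlgebra.ι_add_mul_swap, zero_mul]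

lemma psiAn_psiAn_add (l : ℕ) (ε₁ ε₂ : Bool) (p₁ p₂ : Fin l) (m n : ℕ) (x : FFock l) :
    psiAn l ε₁ p₁ m (psiAn l ε₂ p₂ n x) + psiAn l ε₂ p₂ n (psiAn l ε₁ p₁ m x) = 0 := by
  simp only [psiAn]
  rw [CliffordAlgebra.contractLeft_comm, neg_add_cancel]

lemma psiAn_psiCr_add (l : ℕ) (ε₁ ε₂ : Bool) (p₁ p₂ : Fin l) (m n : ℕ) (x : FFock l) :
    psiAn l ε₁ p₁ m (psiCr l ε₂ p₂ n x) + psiCr l ε₂ p₂ n (psiAn l ε₁ p₁ m x) =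
      if ε₂ = !ε₁ ∧ p₁ = p₂ ∧ m = n then x else 0 := by
  simp only [psiAn, psiCr, ExteriorAlgebra.ι]
  rw [CliffordAlgebra.contractLeft_ι_mul, sub_add_cancel, Finsupp.lapply_apply,
    Finsupp.single_apply, ite_smul, one_smul, zero_smul]
  refine if_congr ?_ rfl rfl
  simp only [Prod.mk.injEq]
  exact and_congr_right' (and_congr eq_comm eq_comm)

/-- The canonical anticommutation relations. -/
lemma fermionHom_anticomm (l : ℕ) (ε₁ ε₂ : Bool) (p₁ p₂ : Fin l) (m n : ℤ) (x : FFock l) :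
    fermionHom l ε₁ p₁ m (fermionHom l ε₂ p₂ n x) +
      fermionHom l ε₂ p₂ n (fermionHom l ε₁ p₁ m x) =
      if ε₂ = !ε₁ ∧ p₁ = p₂ ∧ m + n = 1 then x else 0 := by
  simp only [← fermion_eq_fermionHom, fermion]
  rcases le_or_gt m 0 with hm | hm <;> rcases le_or_gt n 0 with hn | hn
  · simp only [if_pos hm, if_pos hn]
    rw [psiCr_psiCr_add, if_neg fun h => by have := h.2.2; omega]
  · simp only [if_pos hm, if_neg hn.not_ge]
    rw [add_comm, psiAn_psiCr_add]
    refine if_congr (and_congr ?_ (and_congr eq_comm (by omega))) rfl rfl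
    cases ε₁ <;> cases ε₂ <;> simp
  · simp only [if_neg hm.not_ge, if_pos hn]
    rw [psiAn_psiCr_add]
    exact if_congr (and_congr_right' (and_congr_right' (by omega))) rfl rfl
  · simp only [if_neg hm.not_ge, if_neg hn.not_ge]
    rw [psiAn_psiAn_add, if_neg fun h => by have := h.2.2; omega]

/-- Every vector is killed by all annihilation operators of sufficiently high mode. -/
lemma exists_psiAn_eq_zero (l : ℕ) (ε : Bool) (p : Fin l) (x : FFock l) :
    ∃ N, ∀ n, N ≤ n → psiAn l ε p n x = 0 := by
  induction x using CliffordAlgebra.left_induction with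
  | algebraMap r => exact ⟨0, fun n _ => CliffordAlgebra.contractLeft_algebraMap _ _ r⟩
  | add x y hx hy =>
    obtain ⟨N, hN⟩ := hx
    obtain ⟨M, hM⟩ := hy
    refine ⟨max N M, fun n hn => ?_⟩
    have h₁ := hN n (le_trans (le_max_left _ _) hn)
    have h₂ := hM n (le_trans (le_max_right _ _) hn)
    simp only [psiAn] at h₁ h₂ ⊢
    rw [map_add, h₁, h₂, add_zero]
  | ι_mul x v hx =>
    obtain ⟨N, hN⟩ := hx
    have hfin : {n : ℕ | v (!ε, p, n) ≠ 0}.Finite :=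
      v.hasFiniteSupport.preimage fun a _ b _ h => by simpa using h
    obtain ⟨M, hM⟩ := hfin.bddAbove
    refine ⟨max N (M + 1), fun n hn => ?_⟩
    have h₁ := hN n (le_trans (le_max_left _ _) hn)
    have h₂ : v (!ε, p, n) = 0 := by
      by_contra h
      have := hM h
      have := le_trans (le_max_right _ _) hn
      omega
    simp only [psiAn] at h₁ ⊢
    rw [CliffordAlgebra.contractLeft_ι_mul, h₁, Finsupp.lapply_apply, h₂, zero_smul, mul_zero,
      sub_zero]

lemma exists_fermionHom_eq_zero (l : ℕ) (ε : Bool) (p : Fin l) (x : FFock l) :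
    ∃ N : ℤ, ∀ k, N ≤ k → fermionHom l ε p k x = 0 := by
  obtain ⟨N, hN⟩ := exists_psiAn_eq_zero l ε p x
  refine ⟨N + 1, fun k hk => ?_⟩
  rw [← fermion_eq_fermionHom, fermion, if_neg (by omega)]
  exact hN _ (by omega)

lemma nPsi_eq_sub (l : ℕ) (ε₁ ε₂ : Bool) (p₁ p₂ : Fin l) (m n : ℤ) :
    ∃ c : ℂ, ∀ x, nPsi l ε₁ p₁ m ε₂ p₂ n x =
      fermionHom l ε₁ p₁ m (fermionHom l ε₂ p₂ n x) - c • x := by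
  by_cases h : 1 ≤ m ∧ n ≤ 0
  · refine ⟨if ε₂ = !ε₁ ∧ p₁ = p₂ ∧ m + n = 1 then 1 else 0, fun x => ?_⟩
    rw [nPsi, if_pos h, ite_smul, one_smul, zero_smul, ← fermionHom_anticomm]
    simp only [fermion_eq_fermionHom]
    abel
  · refine ⟨0, fun x => ?_⟩
    rw [nPsi, if_neg h, zero_smul, sub_zero]
    simp only [fermion_eq_fermionHom]

lemma nPsi_self (l : ℕ) (ε : Bool) (p q : Fin l) (m n : ℤ) (x : FFock l) :
    nPsi l ε p m ε q n x = fermionHom l ε p m (fermionHom l ε q n x) := by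
  have h := fermionHom_anticomm l ε ε p q m n x
  rw [if_neg (by cases ε <;> simp)] at h
  unfold nPsi
  split_ifs <;> simp only [fermion_eq_fermionHom]
  exact (eq_neg_of_add_eq_zero_left h).symm

/-- The sum `Σ_k :ψ^{ε,p}_{½-k} ψ^{ε,q}_{k-½}:` is locally finite. -/
lemma finite_support_nPsi (l : ℕ) (ε : Bool) (p q : Fin l) (x : FFock l) :
    (Function.support fun k : ℤ => nPsi l ε p (1 - k) ε q k x).Finite := by
  obtain ⟨N, hN⟩ := exists_fermionHom_eq_zero l ε q x
  obtain ⟨M, hM⟩ := exists_fermionHom_eq_zero l ε p x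
  refine (Set.finite_Icc (1 - M) N).subset fun k hk => ?_
  by_contra h
  apply hk
  have h' : N ≤ k ∨ M ≤ 1 - k := by
    simp only [Set.mem_Icc] at h
    omega
  have hc := fermionHom_anticomm l ε ε p q (1 - k) k x
  rw [if_neg (by cases ε <;> simp)] at hc
  simp only [nPsi_self]
  rcases h' with h' | h'
  · rw [hN k h', map_zero]
  · rwa [hM _ h', map_zero, add_zero] at hc

/-- If `[E, ψ^{ε,p}_{k-½}] = δ_{k,a} s ψ^{ε,p}_{b-½}` for all `p` and `k`, then the commutator of
`E` with `Σ_k :ψ^{ε,p}_{½-k} ψ^{ε,q}_{k-½}:` is the sum of its two surviving terms. -/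
lemma map_finsum_nPsi (l : ℕ) (ε : Bool) (p q : Fin l) (E : FFock l →ₗ[ℂ] FFock l)
    (a b : ℤ) (s : ℂ)
    (hE : ∀ p k x, E (fermionHom l ε p k x) =
      fermionHom l ε p k (E x) + if k = a then s • fermionHom l ε p b x else 0)
    (x : FFock l) :
    E (∑ᶠ k : ℤ, nPsi l ε p (1 - k) ε q k x) =
      (∑ᶠ k : ℤ, nPsi l ε p (1 - k) ε q k (E x)) +
        (s • fermionHom l ε p b (fermionHom l ε q (1 - a) x) +
          s • fermionHom l ε p (1 - a) (fermionHom l ε q b x)) := by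
  set u := s • fermionHom l ε p b (fermionHom l ε q (1 - a) x)
  set v := s • fermionHom l ε p (1 - a) (fermionHom l ε q b x)
  have key (k : ℤ) : E (nPsi l ε p (1 - k) ε q k x) = nPsi l ε p (1 - k) ε q k (E x) +
      ((if k = 1 - a then u else 0) + if k = a then v else 0) := by
    rw [nPsi_self, nPsi_self, hE, hE, map_add, add_assoc]
    congr 1
    rw [add_comm]
    congr 1
    · by_cases h : k = 1 - a
      · subst h
        simp [u]
      · rw [if_neg h, if_neg (by omega)]
    · split_ifs with h
      · subst h
        rw [map_smul]
      · exact map_zero _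
  have hfin (c : ℤ) (w : FFock l) : (Function.support fun k : ℤ => if k = c then w else 0).Finite :=
    (Set.finite_singleton c).subset fun k hk => by
      by_contra h
      exact hk (if_neg h)
  have hsum (c : ℤ) (w : FFock l) : (∑ᶠ k : ℤ, if k = c then w else 0) = w := by
    rw [finsum_eq_single _ c fun k hk => if_neg hk, if_pos rfl]
  have hmap := E.toAddMonoidHom.map_finsum (finite_support_nPsi l ε p q x)
  simp only [LinearMap.toAddMonoidHom_coe] at hmap
  rw [hmap, finsum_congr key, finsum_add_distrib (finite_support_nPsi l ε p q (E x)),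
    finsum_add_distrib (hfin _ _) (hfin _ _), hsum, hsum]
  exact ((hfin _ _).union (hfin _ _)).subset (Function.support_add _ _)

lemma exists_Ehat_eq_sub (l : ℕ) (i j : ℤ) :
    ∃ c : ℂ, ∀ x, Ehat l i j x =
      ((∑ p, fermionHom l true p (1 - i) ∘ₗ fermionHom l false p j) -
        c • LinearMap.id : FFock l →ₗ[ℂ] FFock l) x := by
  choose c hc using fun p => nPsi_eq_sub l true false p p (1 - i) j
  refine ⟨∑ p, c p, fun x => ?_⟩
  simp only [Ehat, hc, Finset.sum_sub_distrib, LinearMap.sub_apply, LinearMap.sum_apply,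
    LinearMap.comp_apply, LinearMap.smul_apply, LinearMap.id_apply, Finset.sum_smul]

/-- `Ê_{ij}` is linear, and its commutators with the modes are given by Kronecker deltas. -/
lemma exists_linearMap_eq_Ehat (l : ℕ) (i j : ℤ) :
    ∃ E : FFock l →ₗ[ℂ] FFock l, (∀ x, Ehat l i j x = E x) ∧
      (∀ q k x, E (fermionHom l false q k x) = fermionHom l false q k (E x) +
        if k = i then (-1 : ℂ) • fermionHom l false q j x else 0) ∧
      (∀ q k x, E (fermionHom l true q k x) = fermionHom l true q k (E x) +
        if k = 1 - j then (1 : ℂ) • fermionHom l true q (1 - i) x else 0) := by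
  obtain ⟨c, hc⟩ := exists_Ehat_eq_sub l i j
  refine ⟨_, hc, fun q k x => ?_, fun q k x => ?_⟩
  · have key (p : Fin l) :
        fermionHom l true p (1 - i) (fermionHom l false p j (fermionHom l false q k x)) =
          fermionHom l false q k (fermionHom l true p (1 - i) (fermionHom l false p j x)) +
            if p = q then (if k = i then (-1 : ℂ) • fermionHom l false q j x else 0) else 0 := by
      have h₁ := fermionHom_anticomm l false false p q j k x
      have h₂ := fermionHom_anticomm l true false p q (1 - i) k (fermionHom l false p j x)
      rw [if_neg (by simp)] at h₁
      rw [eq_neg_of_add_eq_zero_left h₁, map_neg, eq_sub_of_add_eq h₂, neg_sub, sub_eq_add_neg]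
      congr 1
      by_cases h : p = q
      · subst h
        have : 1 - i + k = 1 ↔ k = i := by omega
        by_cases hk : k = i <;> simp [this, hk]
      · simp [h]
    simp only [LinearMap.sub_apply, LinearMap.sum_apply, LinearMap.comp_apply,
      LinearMap.smul_apply, LinearMap.id_apply, key, Finset.sum_add_distrib, map_sub, map_sum,
      map_smul, Finset.sum_ite_eq', Finset.mem_univ, if_true]
    abel
  · have key (p : Fin l) :
        fermionHom l true p (1 - i) (fermionHom l false p j (fermionHom l true q k x)) =
          fermionHom l true q k (fermionHom l true p (1 - i) (fermionHom l false p j x)) +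
            if p = q then (if k = 1 - j then (1 : ℂ) • fermionHom l true q (1 - i) x else 0)
              else 0 := by
      have h₁ := fermionHom_anticomm l false true p q j k x
      have h₂ := fermionHom_anticomm l true true p q (1 - i) k (fermionHom l false p j x)
      rw [if_neg (by simp)] at h₂
      rw [eq_sub_of_add_eq h₁, map_sub, eq_neg_of_add_eq_zero_left h₂, sub_neg_eq_add, add_comm]
      congr 1
      by_cases h : p = q
      · subst h
        have : j + k = 1 ↔ k = 1 - j := by omega
        by_cases hk : k = 1 - j <;> simp [this, hk]
      · simp [h]
    simp only [LinearMap.sub_apply, LinearMap.sum_apply, LinearMap.comp_apply,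
      LinearMap.smul_apply, LinearMap.id_apply, key, Finset.sum_add_distrib, map_sub, map_sum,
      map_smul, Finset.sum_ite_eq', Finset.mem_univ, if_true]
    abel

lemma map_sub_finsum_nPsi (l : ℕ) (ε : Bool) (p q : Fin l) (E E' : FFock l →ₗ[ℂ] FFock l)
    (a b : ℤ) (s : ℂ)
    (hE : ∀ p k x, E (fermionHom l ε p k x) =
      fermionHom l ε p k (E x) + if k = a then s • fermionHom l ε p b x else 0)
    (hE' : ∀ p k x, E' (fermionHom l ε p k x) =
      fermionHom l ε p k (E' x) + if k = 1 - b then s • fermionHom l ε p (1 - a) x else 0)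
    (x : FFock l) :
    E (∑ᶠ k : ℤ, nPsi l ε p (1 - k) ε q k x) - E' (∑ᶠ k : ℤ, nPsi l ε p (1 - k) ε q k x) =
      ∑ᶠ k : ℤ, nPsi l ε p (1 - k) ε q k (E x - E' x) := by
  have hsub (k : ℤ) : nPsi l ε p (1 - k) ε q k (E x - E' x) =
      nPsi l ε p (1 - k) ε q k (E x) - nPsi l ε p (1 - k) ε q k (E' x) := by
    simp only [nPsi_self, map_sub]
  rw [finsum_congr hsub, finsum_sub_distrib (finite_support_nPsi ..) (finite_support_nPsi ..),
    map_finsum_nPsi l ε p q E a b s hE, map_finsum_nPsi l ε p q E' _ _ s hE', sub_sub_cancel]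
  abel

/-- for all `i, j ∈ ℤ` and all `1 ≤ p, q ≤ l` with `p ≠ q`, the operator
`D̂_{ij} = Ê_{ij} - Ê_{1-j,1-i}` commutes with `ê^{pq}` and with `ê**^{pq}`. -/
theorem Dhat_comm_ee_estarstar (l : ℕ) (hl : 1 ≤ l) (i j : ℤ) (p q : Fin l) (hpq : p ≠ q)
    (x : FFock l) :
    Dhat l i j (ee l p q x) = ee l p q (Dhat l i j x) ∧
    Dhat l i j (estarstar l p q x) = estarstar l p q (Dhat l i j x) := by
  obtain ⟨E, hE, hEm, hEp⟩ := exists_linearMap_eq_Ehat l i j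
  obtain ⟨E', hE', hEm', hEp'⟩ := exists_linearMap_eq_Ehat l (1 - j) (1 - i)
  simp only [Dhat, hE, hE', ee, estarstar]
  refine ⟨map_sub_finsum_nPsi l false p q E E' i j (-1) hEm hEm' x,
    map_sub_finsum_nPsi l true p q E E' (1 - j) (1 - i) 1 hEp hEp' x⟩

end
end

section
/- (1) For all i, j ∈ ℤ and all p ≠ q, [Ê_{ij}, ê**^{pq}] = ψ^{+,p}_{−i} ψ^{+,q}_{j} − ψ^{+,q}_{−i} ψ^{+,p}_{j} as operators on F. (2) Consequently [Ê_{ij} − Ê_{−j,−i}, ê**^{pq}] = 0 for p ≠ q; likewise [Ê_{ij} − Ê_{−j,−i}, ê^{pq}] = 0 for p ≠ q, and [Ê_{ij}, ê*^{pq}] = 0 for all p, q (hence also [Ê_{ij} − Ê_{−j,−i}, ê*^{pq}] = 0). -/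
/-!
STATEMENT 6. Fermionic Fock space of `l` pairs of fermionic fields indexed by `ℤ`.

The Fock space is the exterior algebra on the space with basis
`v^{+,p}_{-n}` (`n ≥ 1`) and `v^{-,p}_{-n}` (`n ≥ 0`), `1 ≤ p ≤ l`.  We encode the basis
index as `(ε, p, n) : Bool × Fin l × ℕ` with `(true, p, n) ↔ v^{+,p}_{-(n+1)}` and
`(false, p, n) ↔ v^{-,p}_{-n}`.  For the creation ranges, `ψ^{ε,p}_{-n}` is left exterior
multiplication by `v^{ε,p}_{-n}`; `ψ^{+,p}_{n}` (`n ≥ 0`) is the unique odd derivation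
(left contraction) sending `v^{-,p}_{-n}` to `1` and all other basis vectors to `0`, and
`ψ^{-,p}_{n}` (`n ≥ 1`) is the odd derivation sending `v^{+,p}_{-n}` to `1` and all other
basis vectors to `0`.
-/

noncomputable section

/-- Basis index: `(true, p, n) ↔ v^{+,p}_{-(n+1)}`, `(false, p, n) ↔ v^{-,p}_{-n}`. -/
abbrev ZBas (l : ℕ) := Bool × Fin l × ℕ

abbrev ZV (l : ℕ) := ZBas l →₀ ℂ

/-- The fermionic Fock space: the exterior algebra `Λ(V)`. -/
abbrev ZFock (l : ℕ) := ExteriorAlgebra ℂ (ZV l)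

/-- The vacuum vector `|0⟩ = 1`. -/
def zvac (l : ℕ) : ZFock l := 1

/-- Left exterior multiplication by the basis vector with index `b`. -/
def zCr (l : ℕ) (b : ZBas l) : ZFock l → ZFock l :=
  fun x => ExteriorAlgebra.ι ℂ (Finsupp.single b (1 : ℂ)) * x

/-- The odd derivation (left contraction) dual to the basis vector with index `b`. -/
def zAn (l : ℕ) (b : ZBas l) : ZFock l → ZFock l :=
  fun x => CliffordAlgebra.contractLeft (Q := (0 : QuadraticForm ℂ (ZV l)))
    (Finsupp.lapply b) x

/-- The mode `ψ^{ε,p}_{k}`, `k : ℤ`. -/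
def zpsi (l : ℕ) (ε : Bool) (p : Fin l) (k : ℤ) : ZFock l → ZFock l :=
  if ε then
    (if k ≤ -1 then zCr l (true, p, (-k - 1).toNat) else zAn l (false, p, k.toNat))
  else
    (if k ≤ 0 then zCr l (false, p, (-k).toNat) else zAn l (true, p, (k - 1).toNat))

/-- Normal ordered product `:ψ^{+,p}_m ψ^{-,q}_n:`, equal to `ψ^{+,p}_m ψ^{-,q}_n` if
`n ≥ 1` and to `-ψ^{-,q}_n ψ^{+,p}_m` if `n ≤ 0`. -/
def znPM (l : ℕ) (p q : Fin l) (m n : ℤ) : ZFock l → ZFock l :=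
  if 1 ≤ n then fun x => zpsi l true p m (zpsi l false q n x)
  else fun x => -(zpsi l false q n (zpsi l true p m x))

/-- `Ê_{ij} = Σ_{p=1}^{l} :ψ^{+,p}_{-i} ψ^{-,p}_{j}:`. -/
def zEhat (l : ℕ) (i j : ℤ) : ZFock l → ZFock l :=
  fun x => ∑ p : Fin l, znPM l p p (-i) j x

/-- `ê*^{pq} = Σ_{m ∈ ℤ} :ψ^{+,p}_{-m} ψ^{-,q}_{m}:` (a locally finite sum). -/
def zestar (l : ℕ) (p q : Fin l) : ZFock l → ZFock l :=
  fun x => ∑ᶠ m : ℤ, znPM l p q (-m) m x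

/-- `ê**^{pq} = Σ_{m ∈ ℤ} ψ^{+,p}_{-m} ψ^{+,q}_{m}` (a locally finite sum), for `p ≠ q`. -/
def zestarstar (l : ℕ) (p q : Fin l) : ZFock l → ZFock l :=
  fun x => ∑ᶠ m : ℤ, zpsi l true p (-m) (zpsi l true q m x)

/-- `ê^{pq} = Σ_{m ∈ ℤ} ψ^{-,p}_{-m} ψ^{-,q}_{m}` (a locally finite sum), for `p ≠ q`. -/
def zee (l : ℕ) (p q : Fin l) : ZFock l → ZFock l :=
  fun x => ∑ᶠ m : ℤ, zpsi l false p (-m) (zpsi l false q m x)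

namespace ZFock

variable {l : ℕ}

/-- Left exterior multiplication `zCr` as a linear endomorphism. -/
def creation (b : ZBas l) : Module.End ℂ (ZFock l) :=
  LinearMap.mulLeft ℂ (ExteriorAlgebra.ι ℂ (Finsupp.single b (1 : ℂ)))

/-- Left contraction `zAn` as a linear endomorphism. -/
def annihilation (b : ZBas l) : Module.End ℂ (ZFock l) :=
  CliffordAlgebra.contractLeft (Q := (0 : QuadraticForm ℂ (ZV l))) (Finsupp.lapply b)

theorem creation_anticomm (b c : ZBas l) :
    creation b * creation c + creation c * creation b = 0 := by
  refine LinearMap.ext fun x => ?_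
  simp only [creation, LinearMap.add_apply, Module.End.mul_apply, LinearMap.mulLeft_apply,
    ← mul_assoc, ← add_mul, ExteriorAlgebra.ι_add_mul_swap, zero_mul, LinearMap.zero_apply]

theorem annihilation_anticomm (b c : ZBas l) :
    annihilation b * annihilation c + annihilation c * annihilation b = 0 := by
  refine LinearMap.ext fun x => ?_
  simp only [annihilation, LinearMap.add_apply, Module.End.mul_apply, LinearMap.zero_apply]
  rw [CliffordAlgebra.contractLeft_comm, neg_add_cancel]

theorem annihilation_ι_mul (b : ZBas l) (v : ZV l) (x : ZFock l) :
    annihilation b (ExteriorAlgebra.ι ℂ v * x) =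
      v b • x - ExteriorAlgebra.ι ℂ v * annihilation b x :=
  CliffordAlgebra.contractLeft_ι_mul _ _ x

theorem annihilation_creation_anticomm (b c : ZBas l) :
    annihilation b * creation c + creation c * annihilation b = if b = c then 1 else 0 := by
  refine LinearMap.ext fun x => ?_
  simp only [creation, LinearMap.add_apply, Module.End.mul_apply, LinearMap.mulLeft_apply,
    annihilation_ι_mul, sub_add_cancel]
  by_cases h : b = c
  · simp [h]
  · simp [h]

/-- A vector is annihilated by all but finitely many annihilation operators. -/
theorem finite_annihilation_ne_zero (x : ZFock l) : {b | annihilation b x ≠ 0}.Finite := by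
  induction x using CliffordAlgebra.left_induction with
  | algebraMap r => simp [annihilation, CliffordAlgebra.contractLeft_algebraMap]
  | add x y hx hy =>
    refine (hx.union hy).subset fun b hb => ?_
    by_contra h
    simp only [Set.mem_union, Set.mem_ofPred_eq, not_or, not_not] at h
    exact hb (by rw [map_add, h.1, h.2, add_zero])
  | ι_mul x v hx =>
    refine (hx.union v.support.finite_toSet).subset fun b hb => ?_
    by_contra h
    simp only [Set.mem_union, Set.mem_ofPred_eq, SetLike.mem_coe, Finsupp.mem_support_iff, not_or,
      not_not] at h
    exact hb ((annihilation_ι_mul b v x).trans (by rw [h.1, h.2, zero_smul, mul_zero, sub_zero]))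

/-- The mode `zpsi` as a linear endomorphism. -/
def mode (ε : Bool) (p : Fin l) (k : ℤ) : Module.End ℂ (ZFock l) :=
  if ε then
    (if k ≤ -1 then creation (true, p, (-k - 1).toNat) else annihilation (false, p, k.toNat))
  else
    (if k ≤ 0 then creation (false, p, (-k).toNat) else annihilation (true, p, (k - 1).toNat))

theorem mode_apply (ε : Bool) (p : Fin l) (k : ℤ) (x : ZFock l) :
    mode ε p k x = zpsi l ε p k x := by
  unfold mode zpsi
  split_ifs <;> rfl

theorem mode_anticomm_same (ε : Bool) (p q : Fin l) (m n : ℤ) :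
    mode ε p m * mode ε q n + mode ε q n * mode ε p m = 0 := by
  unfold mode
  split_ifs
  all_goals first
    | rw [creation_anticomm]
    | rw [annihilation_anticomm]
    | (rw [annihilation_creation_anticomm]; simp)
    | (rw [add_comm, annihilation_creation_anticomm]; simp)

theorem mode_anticomm (p q : Fin l) (m n : ℤ) :
    mode true p m * mode false q n + mode false q n * mode true p m =
      if p = q ∧ m + n = 0 then 1 else 0 := by
  simp only [mode, if_true, Bool.false_eq_true, if_false]
  split_ifs with hm hn h hn h h h
  all_goals first
    | (exfalso; lia)
    | rw [creation_anticomm]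
    | rw [annihilation_anticomm]
    | (rw [annihilation_creation_anticomm]; simp only [Prod.mk.injEq]; grind)
    | (rw [add_comm, annihilation_creation_anticomm]; simp only [Prod.mk.injEq]; grind)

theorem finite_mode_ne_zero (ε : Bool) (p : Fin l) (x : ZFock l) :
    {k : ℤ | 1 ≤ k ∧ mode ε p k x ≠ 0}.Finite := by
  have h := finite_annihilation_ne_zero x
  refine ((h.image fun b => (b.2.2 : ℤ)).union (h.image fun b => (b.2.2 : ℤ) + 1)).subset ?_
  rintro k ⟨hk, hne⟩
  cases ε
  · refine Or.inr ⟨(true, p, (k - 1).toNat), ?_, by simp; lia⟩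
    simpa [mode, show ¬ k ≤ 0 by lia] using hne
  · refine Or.inl ⟨(false, p, k.toNat), ?_, by simp; lia⟩
    simpa [mode, show ¬ k ≤ -1 by lia] using hne

/-- A family of operators that factor through positive modes far out is locally finite. -/
theorem finite_support_of_mode (ε ε' : Bool) (p q : Fin l) (f : ℤ → Module.End ℂ (ZFock l))
    (x : ZFock l) (hpos : ∀ m, 1 ≤ m → mode ε q m x = 0 → f m x = 0)
    (hneg : ∀ m, m ≤ -1 → mode ε' p (-m) x = 0 → f m x = 0) :
    (Function.support fun m => f m x).Finite := by
  refine (((finite_mode_ne_zero ε q x).union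
    ((finite_mode_ne_zero ε' p x).image Neg.neg)).union (Set.finite_singleton 0)).subset ?_
  intro m hm
  rcases lt_trichotomy m 0 with h | h | h
  · exact Or.inl (Or.inr ⟨-m, ⟨by lia, fun h0 => hm (hneg m (by lia) h0)⟩, neg_neg m⟩)
  · exact Or.inr h
  · exact Or.inl (Or.inl ⟨by lia, fun h0 => hm (hpos m (by lia) h0)⟩)

theorem finite_support_mode_mul_mode (ε : Bool) (p q : Fin l) (x : ZFock l) :
    (Function.support fun m => (mode ε p (-m) * mode ε q m) x).Finite := by
  refine finite_support_of_mode ε ε p q (fun m => mode ε p (-m) * mode ε q m) x ?_ ?_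
  · intro m _ h
    rw [Module.End.mul_apply, h, map_zero]
  · intro m _ h
    rw [eq_neg_of_add_eq_zero_left (mode_anticomm_same ε p q (-m) m), LinearMap.neg_apply,
      Module.End.mul_apply, h, map_zero, neg_zero]

/-- The normal ordered product `znPM` as a linear endomorphism. -/
def normalOrdered (p q : Fin l) (m n : ℤ) : Module.End ℂ (ZFock l) :=
  if 1 ≤ n then mode true p m * mode false q n else -(mode false q n * mode true p m)

theorem normalOrdered_apply (p q : Fin l) (m n : ℤ) (x : ZFock l) :
    normalOrdered p q m n x = znPM l p q m n x := by
  unfold normalOrdered znPM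
  split_ifs <;> simp [mode_apply]

theorem finite_support_normalOrdered (p q : Fin l) (x : ZFock l) :
    (Function.support fun m => normalOrdered p q (-m) m x).Finite := by
  refine finite_support_of_mode false true p q (fun m => normalOrdered p q (-m) m) x ?_ ?_
  · intro m hm h
    simp [normalOrdered, hm, h]
  · intro m hm h
    simp [normalOrdered, show ¬ 1 ≤ m by lia, h]

/-- A normal ordered product differs from the plain product by a scalar. -/
theorem exists_normalOrdered_eq (p q : Fin l) (m n : ℤ) :
    ∃ c : ℂ, normalOrdered p q m n = mode true p m * mode false q n - c • 1 := by
  by_cases hn : 1 ≤ n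
  · exact ⟨0, by simp [normalOrdered, hn]⟩
  · refine ⟨if p = q ∧ m + n = 0 then 1 else 0, ?_⟩
    simp only [normalOrdered, hn, if_false, ite_smul, one_smul, zero_smul, ← mode_anticomm]
    abel

theorem normalOrdered_lie (p q : Fin l) (m n : ℤ) (X : Module.End ℂ (ZFock l)) :
    ⁅normalOrdered p q m n, X⁆ = ⁅mode true p m * mode false q n, X⁆ := by
  obtain ⟨c, hc⟩ := exists_normalOrdered_eq p q m n
  simp [hc, Ring.lie_def, sub_mul, mul_sub]

theorem lie_normalOrdered (p q : Fin l) (m n : ℤ) (X : Module.End ℂ (ZFock l)) :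
    ⁅X, normalOrdered p q m n⁆ = ⁅X, mode true p m * mode false q n⁆ := by
  rw [← neg_inj, Ring.lie_def, Ring.lie_def, neg_sub, neg_sub, ← Ring.lie_def, ← Ring.lie_def,
    normalOrdered_lie]

/-- The operator `zEhat` as a linear endomorphism. -/
def ehat (l : ℕ) (i j : ℤ) : Module.End ℂ (ZFock l) :=
  ∑ p : Fin l, normalOrdered p p (-i) j

theorem ehat_apply (i j : ℤ) (x : ZFock l) : ehat l i j x = zEhat l i j x := by
  simp [ehat, zEhat, normalOrdered_apply]

theorem lie_mul_eq {R : Type*} [Ring R] (a b c : R) : ⁅a, b * c⁆ = ⁅a, b⁆ * c + b * ⁅a, c⁆ := by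
  simp only [Ring.lie_def]
  noncomm_ring

theorem mul_lie_eq_anticomm {R : Type*} [Ring R] (a b c : R) :
    ⁅a * b, c⁆ = a * (c * b + b * c) - (a * c + c * a) * b := by
  simp only [Ring.lie_def]
  noncomm_ring

theorem ehat_lie_mode_true (i j k : ℤ) (p : Fin l) :
    ⁅ehat l i j, mode true p k⁆ = if j + k = 0 then mode true p (-i) else 0 := by
  simp only [ehat, LieRing.of_associative_ring_bracket, Finset.sum_mul, Finset.mul_sum,
    ← Finset.sum_sub_distrib]
  simp only [← LieRing.of_associative_ring_bracket, normalOrdered_lie, mul_lie_eq_anticomm,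
    mode_anticomm, mode_anticomm_same, ite_and, add_comm k]
  simp

theorem ehat_lie_mode_false (i j k : ℤ) (p : Fin l) :
    ⁅ehat l i j, mode false p k⁆ = if k = i then -mode false p j else 0 := by
  simp only [ehat, LieRing.of_associative_ring_bracket, Finset.sum_mul, Finset.mul_sum,
    ← Finset.sum_sub_distrib]
  simp only [← LieRing.of_associative_ring_bracket, normalOrdered_lie, mul_lie_eq_anticomm,
    mode_anticomm, mode_anticomm_same, ite_and, neg_add_eq_zero, eq_comm (a := i)]
  split_ifs <;> simp

/-- Commutators may be computed termwise in locally finite sums. -/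
theorem commutator_finsum (A : Module.End ℂ (ZFock l)) (f : ℤ → Module.End ℂ (ZFock l))
    (hf : ∀ x, (Function.support fun m => f m x).Finite) (x : ZFock l) :
    A (∑ᶠ m, f m x) - ∑ᶠ m, f m (A x) = ∑ᶠ m, ⁅A, f m⁆ x := by
  have hA : (Function.support fun m => A (f m x)).Finite :=
    (hf x).subset fun m hm h => hm (by simp [h])
  rw [map_finsum A (hf x)]
  exact (finsum_sub_distrib hA (hf (A x))).symm

theorem finsum_ite_add_ite (a b : ℤ) (u v : ℤ → ZFock l) :
    ∑ᶠ m, ((if m = a then u m else 0) + if m = b then v m else 0) = u a + v b := by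
  have h (c : ℤ) (w : ℤ → ZFock l) :
      (Function.support fun m => if m = c then w m else 0).Finite :=
    (Set.finite_singleton c).subset fun m hm => by
      by_contra h
      exact hm (if_neg h)
  rw [finsum_add_distrib (h a u) (h b v), finsum_eq_single _ a (fun m hm => if_neg hm),
    finsum_eq_single _ b (fun m hm => if_neg hm), if_pos rfl, if_pos rfl]

theorem zEhat_zestarstar_commutator (i j : ℤ) (p q : Fin l) (x : ZFock l) :
    zEhat l i j (zestarstar l p q x) - zestarstar l p q (zEhat l i j x) =
      zpsi l true p (-i) (zpsi l true q j x) + zpsi l true p j (zpsi l true q (-i) x) := by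
  have h := commutator_finsum (ehat l i j) _ (finite_support_mode_mul_mode true p q) x
  have hm (m : ℤ) : ⁅ehat l i j, mode true p (-m) * mode true q m⁆ x =
      (if m = j then mode true p (-i) (mode true q m x) else 0) +
        if m = -j then mode true p (-m) (mode true q (-i) x) else 0 := by
    rw [lie_mul_eq, ehat_lie_mode_true, ehat_lie_mode_true]
    simp only [show j + -m = 0 ↔ m = j by lia, show j + m = 0 ↔ m = -j by lia]
    split_ifs <;> simp
  simp only [hm, finsum_ite_add_ite] at h
  simpa [mode_apply, ehat_apply, zestarstar] using h

theorem zEhat_zee_commutator (i j : ℤ) (p q : Fin l) (x : ZFock l) :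
    zEhat l i j (zee l p q x) - zee l p q (zEhat l i j x) =
      -zpsi l false p j (zpsi l false q (-i) x) + -zpsi l false p (-i) (zpsi l false q j x) := by
  have h := commutator_finsum (ehat l i j) _ (finite_support_mode_mul_mode false p q) x
  have hm (m : ℤ) : ⁅ehat l i j, mode false p (-m) * mode false q m⁆ x =
      (if m = -i then -mode false p j (mode false q m x) else 0) +
        if m = i then -mode false p (-m) (mode false q j x) else 0 := by
    rw [lie_mul_eq, ehat_lie_mode_false, ehat_lie_mode_false]
    simp only [show -m = i ↔ m = -i by lia]
    split_ifs <;> simp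
  simp only [hm, finsum_ite_add_ite] at h
  simpa [mode_apply, ehat_apply, zee] using h

theorem zEhat_zestar_comm (i j : ℤ) (p q : Fin l) (x : ZFock l) :
    zEhat l i j (zestar l p q x) = zestar l p q (zEhat l i j x) := by
  have h := commutator_finsum (ehat l i j) _ (finite_support_normalOrdered p q) x
  have hm (m : ℤ) : ⁅ehat l i j, normalOrdered p q (-m) m⁆ x =
      (if m = j then mode true p (-i) (mode false q m x) else 0) +
        if m = i then -mode true p (-m) (mode false q j x) else 0 := by
    rw [lie_normalOrdered, lie_mul_eq, ehat_lie_mode_true, ehat_lie_mode_false]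
    simp only [show j + -m = 0 ↔ m = j by lia]
    split_ifs <;> simp
  simp only [hm, finsum_ite_add_ite, add_neg_cancel, sub_eq_zero] at h
  simpa [normalOrdered_apply, ehat_apply, zestar] using h

end ZFock

/-- (1) for `p ≠ q`, `[Ê_{ij}, ê**^{pq}] = ψ^{+,p}_{-i} ψ^{+,q}_{j}
- ψ^{+,q}_{-i} ψ^{+,p}_{j}`; (2) consequently `Ê_{ij} - Ê_{-j,-i}` commutes with `ê**^{pq}`
and with `ê^{pq}` for `p ≠ q`, and `Ê_{ij}` (hence also `Ê_{ij} - Ê_{-j,-i}`) commutes with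
`ê*^{pq}` for all `p, q`. -/
theorem Ehat_estarstar_commutator (l : ℕ) (hl : 1 ≤ l) (i j : ℤ) :
    (∀ p q : Fin l, p ≠ q → ∀ x : ZFock l,
      zEhat l i j (zestarstar l p q x) - zestarstar l p q (zEhat l i j x)
        = zpsi l true p (-i) (zpsi l true q j x) - zpsi l true q (-i) (zpsi l true p j x)) ∧
    (∀ p q : Fin l, p ≠ q → ∀ x : ZFock l,
      (zEhat l i j (zestarstar l p q x) - zEhat l (-j) (-i) (zestarstar l p q x))
          - (zestarstar l p q (zEhat l i j x) - zestarstar l p q (zEhat l (-j) (-i) x)) = 0 ∧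
      (zEhat l i j (zee l p q x) - zEhat l (-j) (-i) (zee l p q x))
          - (zee l p q (zEhat l i j x) - zee l p q (zEhat l (-j) (-i) x)) = 0) ∧
    (∀ p q : Fin l, ∀ x : ZFock l,
      zEhat l i j (zestar l p q x) = zestar l p q (zEhat l i j x) ∧
      (zEhat l i j (zestar l p q x) - zEhat l (-j) (-i) (zestar l p q x))
          - (zestar l p q (zEhat l i j x) - zestar l p q (zEhat l (-j) (-i) x)) = 0) := by
  have anticomm (p q : Fin l) (m n : ℤ) (x : ZFock l) :
      zpsi l true p m (zpsi l true q n x) = -zpsi l true q n (zpsi l true p m x) := by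
    simpa [ZFock.mode_apply] using
      LinearMap.congr_fun (eq_neg_of_add_eq_zero_left (ZFock.mode_anticomm_same true p q m n)) x
  refine ⟨fun p q _ x => ?_, fun p q _ x => ⟨?_, ?_⟩, fun p q x => ⟨?_, ?_⟩⟩
  · rw [ZFock.zEhat_zestarstar_commutator, anticomm p q j, sub_eq_add_neg]
  · rw [sub_sub_sub_comm, ZFock.zEhat_zestarstar_commutator, ZFock.zEhat_zestarstar_commutator,
      neg_neg, add_comm, sub_self]
  · rw [sub_sub_sub_comm, ZFock.zEhat_zee_commutator, ZFock.zEhat_zee_commutator,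
      neg_neg, add_comm, sub_self]
  · exact ZFock.zEhat_zestar_comm i j p q x
  · rw [ZFock.zEhat_zestar_comm, ZFock.zEhat_zestar_comm, sub_self]

end
end

section
/- For all i, j ∈ ℤ and all 1 ≤ p, q ≤ l: [D̂'_{ij}, ê^{p}] = 0, [D̂'_{ij}, ê*^{p}] = 0, and also [D̂'_{ij}, ê*^{pq}] = 0, and [D̂'_{ij}, ê^{pq}] = [D̂'_{ij}, ê**^{pq}] = 0 for p ≠ q. -/
/-!
Fermionic Fock space of `l` pairs of fermionic fields together with one neutral fermionic
field, all indexed by `½ + ℤ`.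

The Fock space `PFock l` is the exterior algebra on the space `PV l` with basis
`v^{ε,p}_{-r}` (`ε ∈ {+,-}`, `1 ≤ p ≤ l`, `r ∈ ½+ℤ`, `r > 0`) and `w_{-r}` (`r ∈ ½+ℤ`,
`r > 0`), encoded as `Sum.inl (ε, p, n)` resp. `Sum.inr n` with `r = n + ½`.
For `r > 0`, `ψ^{ε,p}_{-r}` (resp. `φ_{-r}`) is left exterior multiplication by
`v^{ε,p}_{-r}` (resp. `w_{-r}`), while `ψ^{ε,p}_{r}` (resp. `φ_{r}`) is the unique odd
derivation (left contraction) sending `v^{-ε,p}_{-r}` (resp. `w_{-r}`) to `1` and all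
other basis vectors to `0`.  A general mode with index `k - ½`, `k : ℤ`, is encoded by
`pfermion ε p k` resp. `pphi k`.
-/

noncomputable section

/-- Basis index: `Sum.inl (ε, p, n) ↔ v^{ε,p}_{-(n+½)}`, `Sum.inr n ↔ w_{-(n+½)}`. -/
abbrev PBas (l : ℕ) := (Bool × Fin l × ℕ) ⊕ ℕ

abbrev PV (l : ℕ) := PBas l →₀ ℂ

/-- The Fock space `F' = Λ(V)`. -/
abbrev PFock (l : ℕ) := ExteriorAlgebra ℂ (PV l)

/-- The vacuum vector `|0⟩ = 1`. -/
def pvac (l : ℕ) : PFock l := 1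

/-- Left exterior multiplication by the basis vector with index `b`. -/
def pCr (l : ℕ) (b : PBas l) : PFock l → PFock l :=
  fun x => ExteriorAlgebra.ι ℂ (Finsupp.single b (1 : ℂ)) * x

/-- The odd derivation (left contraction) dual to the basis vector with index `b`. -/
def pAn (l : ℕ) (b : PBas l) : PFock l → PFock l :=
  fun x => CliffordAlgebra.contractLeft (Q := (0 : QuadraticForm ℂ (PV l)))
    (Finsupp.lapply b) x

/-- The mode `ψ^{ε,p}_{k-½}`, `k : ℤ`. -/
def pfermion (l : ℕ) (ε : Bool) (p : Fin l) (k : ℤ) : PFock l → PFock l :=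
  if k ≤ 0 then pCr l (Sum.inl (ε, p, (-k).toNat))
  else pAn l (Sum.inl (!ε, p, (k - 1).toNat))

/-- The neutral fermion mode `φ_{k-½}`, `k : ℤ`. -/
def pphi (l : ℕ) (k : ℤ) : PFock l → PFock l :=
  if k ≤ 0 then pCr l (Sum.inr (-k).toNat) else pAn l (Sum.inr (k - 1).toNat)

/-- Normal ordered product `:ψ^{ε₁,p₁}_{k₁-½} ψ^{ε₂,p₂}_{k₂-½}:`. -/
def pnPsi (l : ℕ) (ε₁ : Bool) (p₁ : Fin l) (k₁ : ℤ) (ε₂ : Bool) (p₂ : Fin l) (k₂ : ℤ) :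
    PFock l → PFock l :=
  if 1 ≤ k₁ ∧ k₂ ≤ 0 then fun x => -(pfermion l ε₂ p₂ k₂ (pfermion l ε₁ p₁ k₁ x))
  else fun x => pfermion l ε₁ p₁ k₁ (pfermion l ε₂ p₂ k₂ x)

/-- Normal ordered product `:φ_{k₁-½} φ_{k₂-½}:`. -/
def pnPhi (l : ℕ) (k₁ k₂ : ℤ) : PFock l → PFock l :=
  if 1 ≤ k₁ ∧ k₂ ≤ 0 then fun x => -(pphi l k₂ (pphi l k₁ x))
  else fun x => pphi l k₁ (pphi l k₂ x)

/-- Normal ordered product `:ψ^{ε,p}_{k₁-½} φ_{k₂-½}:`. -/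
def pnPsiPhi (l : ℕ) (ε : Bool) (p : Fin l) (k₁ k₂ : ℤ) : PFock l → PFock l :=
  if 1 ≤ k₁ ∧ k₂ ≤ 0 then fun x => -(pphi l k₂ (pfermion l ε p k₁ x))
  else fun x => pfermion l ε p k₁ (pphi l k₂ x)

/-- `Ê_{ij} = Σ_{p=1}^{l} :ψ^{+,p}_{½-i} ψ^{-,p}_{j-½}:`. -/
def pEhat (l : ℕ) (i j : ℤ) : PFock l → PFock l :=
  fun x => ∑ p : Fin l, pnPsi l true p (1 - i) false p j x

/-- `D̂'_{ij} = Ê_{ij} - Ê_{1-j,1-i} + :φ_{½-i} φ_{j-½}:`. -/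
def pDhat (l : ℕ) (i j : ℤ) : PFock l → PFock l :=
  fun x => pEhat l i j x - pEhat l (1 - j) (1 - i) x + pnPhi l (1 - i) j x

/-- `ê*^{pq} = Σ_{r∈½+ℤ} :ψ^{+,p}_{-r} ψ^{-,q}_{r}:` (locally finite sum, `r = k - ½`). -/
def pestar (l : ℕ) (p q : Fin l) : PFock l → PFock l :=
  fun x => ∑ᶠ k : ℤ, pnPsi l true p (1 - k) false q k x

/-- `ê^{pq} = Σ_{r∈½+ℤ} :ψ^{-,p}_{-r} ψ^{-,q}_{r}:`. -/
def pee (l : ℕ) (p q : Fin l) : PFock l → PFock l :=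
  fun x => ∑ᶠ k : ℤ, pnPsi l false p (1 - k) false q k x

/-- `ê**^{pq} = Σ_{r∈½+ℤ} :ψ^{+,p}_{-r} ψ^{+,q}_{r}:`. -/
def pestarstar (l : ℕ) (p q : Fin l) : PFock l → PFock l :=
  fun x => ∑ᶠ k : ℤ, pnPsi l true p (1 - k) true q k x

/-- `ê^{p} = Σ_{r∈½+ℤ} :ψ^{-,p}_{-r} φ_{r}:`. -/
def peeN (l : ℕ) (p : Fin l) : PFock l → PFock l :=
  fun x => ∑ᶠ k : ℤ, pnPsiPhi l false p (1 - k) k x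

/-- `ê*^{p} = Σ_{r∈½+ℤ} :ψ^{+,p}_{-r} φ_{r}:`. -/
def pestarN (l : ℕ) (p : Fin l) : PFock l → PFock l :=
  fun x => ∑ᶠ k : ℤ, pnPsiPhi l true p (1 - k) k x

namespace PFock

variable {l : ℕ}

/-- The labels of the fermionic fields: `some (ε, p)` is `ψ^{ε,p}` and `none` is `φ`. -/
abbrev Label (l : ℕ) := Option (Bool × Fin l)

/-- The label of the dual field. -/
def Label.dual (a : Label l) : Label l := a.map fun b => (!b.1, b.2)

@[simp] theorem Label.dual_dual (a : Label l) : a.dual.dual = a := by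
  rcases a with _ | ⟨ε, p⟩ <;> simp [Label.dual]

theorem Label.eq_dual_comm {a b : Label l} : a = b.dual ↔ b = a.dual :=
  ⟨fun h => by simp [h], fun h => by simp [h]⟩

/-- The basis index of mode `-(n + ½)` of the field with a given label. -/
def basisIndex : Label l → ℕ → PBas l
  | some (ε, p), n => Sum.inl (ε, p, n)
  | none, n => Sum.inr n

theorem basisIndex_inj {a b : Label l} {m n : ℕ} :
    basisIndex a m = basisIndex b n ↔ a = b ∧ m = n := by
  rcases a with _ | ⟨ε, p⟩ <;> rcases b with _ | ⟨ε', p'⟩ <;> simp [basisIndex, and_assoc]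

/-- Creation operators as linear maps. -/
def creation (b : PBas l) : Module.End ℂ (PFock l) :=
  LinearMap.mulLeft ℂ (ExteriorAlgebra.ι ℂ (Finsupp.single b (1 : ℂ)))

/-- Annihilation operators as linear maps. -/
def annihilation (b : PBas l) : Module.End ℂ (PFock l) :=
  CliffordAlgebra.contractLeft (Q := (0 : QuadraticForm ℂ (PV l))) (Finsupp.lapply b)

theorem annihilation_ι_mul (b : PBas l) (v : PV l) (x : PFock l) :
    annihilation b (ExteriorAlgebra.ι ℂ v * x) =
      v b • x - ExteriorAlgebra.ι ℂ v * annihilation b x :=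
  CliffordAlgebra.contractLeft_ι_mul (Q := (0 : QuadraticForm ℂ (PV l))) _ _ _

theorem creation_anticomm (b c : PBas l) :
    creation b * creation c + creation c * creation b = 0 := by
  refine LinearMap.ext fun x => ?_
  simp only [creation, LinearMap.add_apply, Module.End.mul_apply, LinearMap.mulLeft_apply,
    ← mul_assoc, ← add_mul, LinearMap.zero_apply]
  rw [ExteriorAlgebra.ι_add_mul_swap, zero_mul]

theorem annihilation_anticomm (b c : PBas l) :
    annihilation b * annihilation c + annihilation c * annihilation b = 0 := by
  refine LinearMap.ext fun x => ?_
  simp only [annihilation, LinearMap.add_apply, Module.End.mul_apply, LinearMap.zero_apply]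
  rw [CliffordAlgebra.contractLeft_comm, neg_add_cancel]

theorem annihilation_creation_anticomm (b c : PBas l) :
    annihilation b * creation c + creation c * annihilation b = if b = c then 1 else 0 := by
  refine LinearMap.ext fun x => ?_
  simp only [creation, LinearMap.add_apply, Module.End.mul_apply, LinearMap.mulLeft_apply,
    annihilation_ι_mul, sub_add_cancel, Finsupp.single_apply, eq_comm (a := c)]
  split_ifs <;> simp

theorem finite_annihilation_ne_zero (x : PFock l) : {b | annihilation b x ≠ 0}.Finite := by
  induction x using CliffordAlgebra.left_induction with
  | algebraMap r => simp [annihilation, CliffordAlgebra.contractLeft_algebraMap]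
  | add x y hx hy =>
    refine (hx.union hy).subset fun b hb => ?_
    by_contra! h
    simp_all
  | ι_mul x v hx =>
    refine (hx.union v.hasFiniteSupport).subset fun b hb => ?_
    by_contra h
    simp only [Set.mem_union, Set.mem_ofPred_eq, Function.mem_support, not_or, not_not] at h
    refine hb ((annihilation_ι_mul b v x).trans ?_)
    rw [h.1, h.2, zero_smul, mul_zero, sub_zero]

/-- The mode with index `k - ½` of the field with a given label. -/
def mode (a : Label l) (k : ℤ) : Module.End ℂ (PFock l) :=
  if k ≤ 0 then creation (basisIndex a (-k).toNat)
  else annihilation (basisIndex a.dual (k - 1).toNat)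

theorem mode_anticomm (a b : Label l) (k m : ℤ) :
    mode a k * mode b m + mode b m * mode a k = if b = a.dual ∧ k + m = 1 then 1 else 0 := by
  unfold mode
  split_ifs with hk hm h h hm h h
  · omega
  · exact creation_anticomm _ _
  · rw [add_comm, annihilation_creation_anticomm, if_pos]
    rw [basisIndex_inj, h.1, Label.dual_dual]
    exact ⟨rfl, by omega⟩
  · rw [add_comm, annihilation_creation_anticomm, if_neg]
    rw [basisIndex_inj, eq_comm, Label.eq_dual_comm]
    exact fun h' => h ⟨h'.1, by omega⟩
  · rw [annihilation_creation_anticomm, if_pos]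
    rw [basisIndex_inj, h.1]
    exact ⟨rfl, by omega⟩
  · rw [annihilation_creation_anticomm, if_neg]
    rw [basisIndex_inj, eq_comm]
    exact fun h' => h ⟨h'.1, by omega⟩
  · omega
  · exact annihilation_anticomm _ _

theorem finite_mode_ne_zero (a : Label l) (x : PFock l) :
    {k : ℤ | 0 < k ∧ mode a k x ≠ 0}.Finite := by
  refine Set.Finite.of_injOn (f := fun k : ℤ => basisIndex a.dual (k - 1).toNat)
    ?_ ?_ (finite_annihilation_ne_zero x)
  · rintro k ⟨hk, h⟩
    rwa [mode, if_neg hk.not_ge] at h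
  · rintro k ⟨hk, -⟩ m ⟨hm, -⟩ h
    have := (basisIndex_inj.1 h).2
    omega

/-- The normally ordered product of two modes. -/
def normalOrdered (a : Label l) (k : ℤ) (b : Label l) (m : ℤ) : Module.End ℂ (PFock l) :=
  if 1 ≤ k ∧ m ≤ 0 then -(mode b m * mode a k) else mode a k * mode b m

theorem normalOrdered_antisymm (a b : Label l) (k m : ℤ) :
    normalOrdered a k b m = -normalOrdered b m a k := by
  unfold normalOrdered
  split_ifs with h h' h'
  · omega
  · rfl
  · rw [neg_neg]
  · rw [eq_neg_iff_add_eq_zero, mode_anticomm, if_neg]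
    omega

theorem exists_normalOrdered_eq (a b : Label l) (k m : ℤ) :
    ∃ r : ℂ, normalOrdered a k b m = mode a k * mode b m - algebraMap ℂ _ r := by
  unfold normalOrdered
  split_ifs
  · have h := mode_anticomm a b k m
    split_ifs at h
    · exact ⟨1, by rw [map_one, ← h]; abel⟩
    · exact ⟨0, by rw [map_zero, ← h]; abel⟩
  · exact ⟨0, by simp⟩

theorem lie_normalOrdered (A : Module.End ℂ (PFock l)) (a b : Label l) (k m : ℤ) :
    ⁅A, normalOrdered a k b m⁆ = ⁅A, mode a k⁆ * mode b m + mode a k * ⁅A, mode b m⁆ := by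
  obtain ⟨r, hr⟩ := exists_normalOrdered_eq a b k m
  simp only [hr, Ring.lie_def, mul_sub, sub_mul, Algebra.commutes r A]
  noncomm_ring

theorem normalOrdered_lie_mode (a b c : Label l) (k m n : ℤ) :
    ⁅normalOrdered a k b m, mode c n⁆ =
      (if c = b.dual ∧ m + n = 1 then mode a k else 0) -
        if c = a.dual ∧ k + n = 1 then mode b m else 0 := by
  obtain ⟨r, hr⟩ := exists_normalOrdered_eq a b k m
  have h₁ := congrArg (mode a k * ·) (mode_anticomm b c m n)
  have h₂ := congrArg (· * mode b m) (mode_anticomm a c k n)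
  simp only [mul_ite, ite_mul, mul_one, one_mul, mul_zero, zero_mul] at h₁ h₂
  rw [hr, ← h₁, ← h₂, Ring.lie_def, sub_mul, mul_sub, Algebra.commutes r (mode c n)]
  noncomm_ring

theorem finite_normalOrdered_ne_zero (a b : Label l) (x : PFock l) :
    {k : ℤ | normalOrdered a (1 - k) b k x ≠ 0}.Finite := by
  refine ((finite_mode_ne_zero b x).union
    ((finite_mode_ne_zero a x).preimage (f := fun k => 1 - k)
      (sub_right_injective.injOn))).subset fun k hk => ?_
  by_contra h
  simp only [Set.mem_union, Set.mem_preimage, Set.mem_ofPred_eq, not_or, not_and, not_not] at h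
  refine hk ?_
  unfold normalOrdered
  split_ifs with h'
  · simp [h.2 (by omega)]
  · simp [h.1 (by omega)]

/-- The operator `D̂'_{ij}`, as a sum of normally ordered products over all fields. -/
def dHat (i j : ℤ) : Module.End ℂ (PFock l) :=
  ∑ a : Label l, normalOrdered a (1 - i) a.dual j

theorem dHat_lie_mode (i j : ℤ) (c : Label l) (n : ℤ) :
    ⁅(dHat i j : Module.End ℂ (PFock l)), mode c n⁆ =
      (if n = 1 - j then mode c (1 - i) else 0) - if n = i then mode c j else 0 := by
  have h (a : Label l) : c = a.dual ↔ a = c.dual := Label.eq_dual_comm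
  have hj : j + n = 1 ↔ n = 1 - j := by omega
  have hi : 1 - i + n = 1 ↔ n = i := by omega
  rw [dHat, Ring.lie_def, Finset.sum_mul, Finset.mul_sum, ← Finset.sum_sub_distrib]
  simp only [← Ring.lie_def, normalOrdered_lie_mode, Label.dual_dual, Finset.sum_sub_distrib,
    hi, hj, h, ite_and]
  simp only [Finset.sum_ite_eq, Finset.sum_ite_eq', Finset.mem_univ, if_true,
    Label.dual_dual]

theorem dHat_lie_normalOrdered (i j k : ℤ) (a b : Label l) :
    ⁅(dHat i j : Module.End ℂ (PFock l)), normalOrdered a (1 - k) b k⁆ =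
      ((if k = j then mode a (1 - i) * mode b j else 0) -
        if k = i then mode a (1 - i) * mode b j else 0) +
      ((if k = 1 - j then mode a j * mode b (1 - i) else 0) -
        if k = 1 - i then mode a j * mode b (1 - i) else 0) := by
  have hj : 1 - k = 1 - j ↔ k = j := by omega
  have hi : 1 - k = i ↔ k = 1 - i := by omega
  rw [lie_normalOrdered, dHat_lie_mode, dHat_lie_mode, sub_mul, mul_sub]
  simp only [hi, hj, mul_ite, ite_mul, mul_zero, zero_mul]
  have e₁ : (if k = j then mode a (1 - i) * mode b k else 0) =
      if k = j then mode a (1 - i) * mode b j else 0 := by split_ifs with h <;> simp [h]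
  have e₂ : (if k = 1 - i then mode a j * mode b k else 0) =
      if k = 1 - i then mode a j * mode b (1 - i) else 0 := by split_ifs with h <;> simp [h]
  have e₃ : (if k = 1 - j then mode a (1 - k) * mode b (1 - i) else 0) =
      if k = 1 - j then mode a j * mode b (1 - i) else 0 := by split_ifs with h <;> simp [h]
  have e₄ : (if k = i then mode a (1 - k) * mode b j else 0) =
      if k = i then mode a (1 - i) * mode b j else 0 := by split_ifs with h <;> simp [h]
  rw [e₁, e₂, e₃, e₄]
  abel

/-- The operator `D̂'_{ij}` commutes with the zero mode of the normally ordered product of any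
two fields. -/
theorem dHat_finsum_normalOrdered (i j : ℤ) (a b : Label l) (x : PFock l) :
    dHat i j (∑ᶠ k : ℤ, normalOrdered a (1 - k) b k x) =
      ∑ᶠ k : ℤ, normalOrdered a (1 - k) b k (dHat i j x) := by
  classical
  have hx := finite_normalOrdered_ne_zero a b x
  have hy := finite_normalOrdered_ne_zero a b (dHat i j x)
  let S : Finset ℤ := hx.toFinset ∪ hy.toFinset ∪ {i, j, 1 - i, 1 - j}
  rw [finsum_eq_sum_of_support_subset (s := S), finsum_eq_sum_of_support_subset (s := S)]
  · rw [map_sum, ← sub_eq_zero, ← Finset.sum_sub_distrib]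
    have h : ∑ k ∈ S, ⁅(dHat i j : Module.End ℂ (PFock l)), normalOrdered a (1 - k) b k⁆ = 0 := by
      simp only [dHat_lie_normalOrdered, Finset.sum_add_distrib, Finset.sum_sub_distrib,
        Finset.sum_ite_eq']
      simp [S]
    simpa [Ring.lie_def] using congrArg (· x) h
  · intro k hk
    simp only [S, Finset.coe_union, Set.Finite.coe_toFinset]
    exact .inl (.inr hk)
  · intro k hk
    simp only [S, Finset.coe_union, Set.Finite.coe_toFinset]
    exact .inl (.inl hk)

theorem pfermion_eq_mode (ε : Bool) (p : Fin l) (k : ℤ) :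
    pfermion l ε p k = mode (some (ε, p)) k := by
  unfold pfermion mode
  split_ifs <;> rfl

theorem pphi_eq_mode (k : ℤ) : pphi l k = mode none k := by
  unfold pphi mode
  split_ifs <;> rfl

theorem pnPsi_eq_normalOrdered (ε₁ ε₂ : Bool) (p₁ p₂ : Fin l) (k₁ k₂ : ℤ) :
    pnPsi l ε₁ p₁ k₁ ε₂ p₂ k₂ = normalOrdered (some (ε₁, p₁)) k₁ (some (ε₂, p₂)) k₂ := by
  unfold pnPsi normalOrdered
  simp only [pfermion_eq_mode]
  split_ifs <;> rfl

theorem pnPhi_eq_normalOrdered (k₁ k₂ : ℤ) :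
    pnPhi l k₁ k₂ = normalOrdered none k₁ none k₂ := by
  unfold pnPhi normalOrdered
  simp only [pphi_eq_mode]
  split_ifs <;> rfl

theorem pnPsiPhi_eq_normalOrdered (ε : Bool) (p : Fin l) (k₁ k₂ : ℤ) :
    pnPsiPhi l ε p k₁ k₂ = normalOrdered (some (ε, p)) k₁ none k₂ := by
  unfold pnPsiPhi normalOrdered
  simp only [pfermion_eq_mode, pphi_eq_mode]
  split_ifs <;> rfl

theorem pDhat_eq_dHat (i j : ℤ) : pDhat l i j = dHat i j := by
  funext x
  have h (p : Fin l) : normalOrdered (some (false, p)) (1 - i) (some (true, p)) j x =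
      -normalOrdered (some (true, p)) j (some (false, p)) (1 - i) x := by
    rw [normalOrdered_antisymm, LinearMap.neg_apply]
  simp only [pDhat, pEhat, dHat, pnPsi_eq_normalOrdered, pnPhi_eq_normalOrdered,
    Fintype.sum_option, Fintype.sum_prod_type, Fintype.sum_bool, Label.dual, Option.map_some,
    Option.map_none, Bool.not_true, Bool.not_false, LinearMap.add_apply, LinearMap.sum_apply,
    h, Finset.sum_neg_distrib, sub_sub_cancel]
  abel

end PFock

/-- for all `i, j ∈ ℤ` and `1 ≤ p, q ≤ l`, the operator
`D̂'_{ij} = Ê_{ij} - Ê_{1-j,1-i} + :φ_{½-i} φ_{j-½}:` commutes with `ê^{p}`, `ê*^{p}` and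
`ê*^{pq}`, and with `ê^{pq}` and `ê**^{pq}` for `p ≠ q`. -/
theorem pDhat_comm_so_odd (l : ℕ) (hl : 1 ≤ l) (i j : ℤ) (p q : Fin l) (x : PFock l) :
    pDhat l i j (peeN l p x) = peeN l p (pDhat l i j x) ∧
    pDhat l i j (pestarN l p x) = pestarN l p (pDhat l i j x) ∧
    pDhat l i j (pestar l p q x) = pestar l p q (pDhat l i j x) ∧
    (p ≠ q → pDhat l i j (pee l p q x) = pee l p q (pDhat l i j x) ∧
      pDhat l i j (pestarstar l p q x) = pestarstar l p q (pDhat l i j x)) := by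
  simp only [pestar, pee, pestarstar, peeN, pestarN, PFock.pDhat_eq_dHat,
    PFock.pnPsi_eq_normalOrdered, PFock.pnPsiPhi_eq_normalOrdered,
    PFock.dHat_finsum_normalOrdered, and_self, implies_true]

end
end
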